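/- arXiv:1405.5188 — 3 statements merged into one kernel-verified Lean document; each statement's English description precedes it below -/
import Mathlib

section
/- Let (R, m, k) be a commutative Noetherian local ring and let N be a nonzero finitely generated Tor-rigid R-module. If the injective dimension of N is finite, then R is Gorenstein. -/
open CategoryTheory

noncomputable section

variable (R : Type) [CommRing R]

/-- `Ext^n_R(M,N)` as an `R`-module object. -/
abbrev ext (n : ℕ) (M N : ModuleCat R) : ModuleCat R :=
  ((Ext R (ModuleCat R) n).obj (Opposite.op M)).obj N

/-- `Tor_n^R(M,N)`. -/
abbrev tor (n : ℕ) (M N : ModuleCat R) : ModuleCat R :=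
  ((Tor (ModuleCat R) n).obj M).obj N

/-- projective dimension, via vanishing of `Ext` in degrees above `n`. -/
def projDim (M : ModuleCat R) : ℕ∞ :=
  sInf {n : ℕ∞ | ∀ (i : ℕ) (X : ModuleCat R), n < i → Subsingleton (ext R i M X)}

/-- injective dimension, via vanishing of `Ext` in degrees above `n`. -/
def injDim (N : ModuleCat R) : ℕ∞ :=
  sInf {n : ℕ∞ | ∀ (i : ℕ) (X : ModuleCat R), n < i → Subsingleton (ext R i X N)}

/-- depth over a local ring, as the least `n` with `Ext^n(k, N) ≠ 0`. -/
def depth [IsLocalRing R] (N : ModuleCat R) : ℕ∞ :=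
  sInf {n : ℕ∞ | ∃ i : ℕ, n = i ∧
    ¬ Subsingleton (ext R i (ModuleCat.of R (IsLocalRing.ResidueField R)) N)}

/-- Tor-rigidity. -/
def TorRigid (N : ModuleCat R) : Prop :=
  ∀ (X : ModuleCat R), Module.Finite R X → ∀ n : ℕ, 1 ≤ n →
    Subsingleton (tor R n N X) → Subsingleton (tor R (n + 1) N X)

/-- test module for projectivity. -/
def TestModule (M : ModuleCat R) : Prop :=
  ∀ (X : ModuleCat R), Module.Finite R X → projDim R X = ⊤ →
    {j : ℕ | ¬ Subsingleton (tor R j M X)}.Infinite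

/-- strongly-rigid module. -/
def StronglyRigid (N : ModuleCat R) : Prop :=
  ∀ (X : ModuleCat R), Module.Finite R X → ∀ n : ℕ, 1 ≤ n →
    Subsingleton (tor R n N X) → projDim R X < ⊤

/-- rigid-test module. -/
def RigidTest (N : ModuleCat R) : Prop :=
  ∀ (X : ModuleCat R), Module.Finite R X → ∀ n : ℕ, 1 ≤ n →
    Subsingleton (tor R n N X) →
      Subsingleton (tor R (n + 1) N X) ∧ projDim R X < ⊤


open Limits Abelian

section aux
variable {R}

/-- a projective complex with prescribed first differential. -/
def resComplex {Q₁ Q₀ : ModuleCat.{0} R} (d : Q₁ ⟶ Q₀) : ChainComplex (ModuleCat.{0} R) ℕ :=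
  ChainComplex.mk' Q₀ Q₁ d (fun f => ⟨_, Projective.d f, (Category.assoc _ _ _).trans ((congrArg _ (kernel.condition f)).trans comp_zero)⟩)

lemma of_exact (X : ℕ → ModuleCat.{0} R) (d : ∀ n, X (n + 1) ⟶ X n)
    (sq : ∀ n, d (n + 1) ≫ d n = 0) (n : ℕ)
    (h : (ShortComplex.mk (d (n + 1)) (d n) (sq n)).Exact) :
    (ChainComplex.of X d sq).ExactAt (n + 1) := by
  rw [HomologicalComplex.exactAt_iff' _ (n + 1 + 1) (n + 1) n (by simp) (by simp)]
  have e : ShortComplex.mk (d (n + 1)) (d n) (sq n) ≅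
      (ChainComplex.of X d sq).sc' (n + 1 + 1) (n + 1) n :=
    ShortComplex.isoMk (Iso.refl _) (Iso.refl _) (Iso.refl _)
      ((Category.id_comp _).trans ((ChainComplex.of_d X d (n + 1)).trans
        (Category.comp_id _).symm))
      ((Category.id_comp _).trans ((ChainComplex.of_d X d n).trans
        (Category.comp_id _).symm))
  exact ShortComplex.exact_of_iso e h

lemma resComplex_exactAt {Q₁ Q₀ : ModuleCat.{0} R} (d : Q₁ ⟶ Q₀) (n : ℕ) :
    (resComplex d).ExactAt (n + 1) := by
  unfold resComplex ChainComplex.mk' ChainComplex.mk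
  refine of_exact _ _ _ n ?_
  match n with
  | 0 => apply exact_d_f
  | n + 1 => apply exact_d_f

instance resComplex_proj {Q₁ Q₀ : ModuleCat.{0} R} (d : Q₁ ⟶ Q₀) [Projective Q₁] [Projective Q₀]
    (n : ℕ) : Projective ((resComplex d).X n) := by
  obtain (_ | _ | _ | n) := n
  · assumption
  · assumption
  · apply Projective.projective_over
  · apply Projective.projective_over

lemma resComplex_d {Q₁ Q₀ : ModuleCat.{0} R} (d : Q₁ ⟶ Q₀) : (resComplex d).d 1 0 = d := by
  simp [resComplex]

lemma exists_res {Q₁ Q₀ : ModuleCat.{0} R} (d : Q₁ ⟶ Q₀) [Projective Q₁] [Projective Q₀]  :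
    ∃ P : ProjectiveResolution (cokernel d), P.complex = resComplex d := by
  refine ⟨{
    complex := resComplex d
    π := (ChainComplex.toSingle₀Equiv _ _).symm ⟨cokernel.π d, by
          rw [resComplex_d]; exact cokernel.condition d⟩
    quasiIso := ⟨fun n => by
      cases n
      · rw [ChainComplex.quasiIsoAt₀_iff, ShortComplex.quasiIso_iff_of_zeros']
        · refine (ShortComplex.exact_and_epi_g_iff_of_iso ?_).2
            ⟨ShortComplex.exact_cokernel d, by dsimp; infer_instance⟩
          exact ShortComplex.isoMk (Iso.refl _) (Iso.refl _) (Iso.refl _)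
            ((Category.id_comp _).trans ((resComplex_d d).symm.trans (Category.comp_id _).symm)) (by simp; rfl)
        all_goals rfl
      · rw [quasiIsoAt_iff_exactAt']
        · apply resComplex_exactAt
        · apply ChainComplex.exactAt_succ_single_obj⟩ }, rfl⟩

lemma tor_iff (N : ModuleCat.{0} R) {D : ModuleCat.{0} R} (P : ProjectiveResolution D) (n : ℕ) :
    Subsingleton (tor R (n+1) N D) ↔
      Function.Exact ((P.complex.d (n+2) (n+1)).hom.lTensor N)
        ((P.complex.d (n+1) n).hom.lTensor N) := by
  have e := P.isoLeftDerivedObj ((MonoidalCategory.tensoringLeft (ModuleCat R)).obj N) (n+1)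
  rw [← ModuleCat.isZero_iff_subsingleton]
  have h1 : IsZero (tor R (n+1) N D) ↔ _ := e.isZero_iff
  rw [h1]
  refine (HomologicalComplex.exactAt_iff_isZero_homology _ _).symm.trans ?_
  rw [HomologicalComplex.exactAt_iff' _ (n + 1 + 1) (n + 1) n (by simp) (by simp),
    ShortComplex.ShortExact.moduleCat_exact_iff_function_exact]
  rfl

lemma ext_iff' (N : ModuleCat.{0} R) {D : ModuleCat.{0} R} (P : ProjectiveResolution D) (n : ℕ) :
    Subsingleton (ext R (n+1) D N) ↔
      ∀ f : P.complex.X (n+1) ⟶ N, P.complex.d (n+2) (n+1) ≫ f = 0 →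
        ∃ g : P.complex.X n ⟶ N, P.complex.d (n+1) n ≫ g = f := by
  have e := P.isoExt (R := R) (n+1) N
  rw [← ModuleCat.isZero_iff_subsingleton]
  have h1 : IsZero (ext R (n+1) D N) ↔ _ := e.isZero_iff
  rw [h1]
  refine (HomologicalComplex.exactAt_iff_isZero_homology _ _).symm.trans ?_
  rw [HomologicalComplex.exactAt_iff' _ n (n + 1) (n+2) (by simp) (by simp),
    ShortComplex.moduleCat_exact_iff]
  rfl

lemma ext_bridge (N D : ModuleCat.{0} R) (n : ℕ) :
    Subsingleton (ext R (n+1) D N) ↔ Subsingleton (Abelian.Ext.{0} D N (n+1)) := by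
  let P := projectiveResolution D
  rw [ext_iff' N P]
  constructor
  · intro h
    refine subsingleton_of_forall_eq 0 fun e => ?_
    obtain ⟨f, hf, rfl⟩ := P.extMk_surjective e (n+2) rfl
    rw [P.extMk_eq_zero_iff f (n+2) rfl hf n rfl]
    exact h f hf
  · intro h f hf
    rw [← P.extMk_eq_zero_iff f (n+2) rfl hf n rfl]
    exact Subsingleton.elim _ _

open TensorProduct in
lemma subsingleton_of_tensor [IsLocalRing R] (N E : Type) [AddCommGroup N] [Module R N]
    [AddCommGroup E] [Module R E] [Module.Finite R N] [Module.Finite R E] [Nontrivial N]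
    (h : Subsingleton (N ⊗[R] E)) : Subsingleton E := by
  let k := IsLocalRing.ResidueField R
  have hN : Nontrivial (k ⊗[R] N) := by
    by_contra hc
    rw [not_nontrivial_iff_subsingleton, IsLocalRing.subsingleton_tensorProduct] at hc
    exact not_subsingleton N hc
  rw [← IsLocalRing.subsingleton_tensorProduct (R := R)]
  by_contra hc
  rw [not_subsingleton_iff_nontrivial] at hc
  have e : k ⊗[R] (N ⊗[R] E) ≃ₗ[k] (k ⊗[R] N) ⊗[k] (k ⊗[R] E) :=
    TensorProduct.AlgebraTensorModule.distribBaseChange R k N E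
  have : Subsingleton ((k ⊗[R] N) ⊗[k] (k ⊗[R] E)) := e.symm.toEquiv.subsingleton
  have h3 : Nontrivial ((k ⊗[R] N) ⊗[k] (k ⊗[R] E)) := inferInstance
  exact not_subsingleton _ this

lemma core [IsNoetherianRing R] [IsLocalRing R]
    (N : ModuleCat.{0} R) [Module.Finite R N] (hN : Nontrivial N) (hrig : TorRigid R N)
    {A Q₁ Q₀ : Type} [AddCommGroup A] [Module R A] [AddCommGroup Q₁] [Module R Q₁]
    [AddCommGroup Q₀] [Module R Q₀] [Module.Finite R Q₁] [Module.Finite R Q₀]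
    [Module.Free R Q₁] [Module.Free R Q₀] (α : A →ₗ[R] Q₁) (β : Q₁ →ₗ[R] Q₀)
    (h0 : β ∘ₗ α = 0) (hex : Function.Exact (α.lTensor N) (β.lTensor N)) :
    Function.Exact α β := by
  have hp1 : Projective (ModuleCat.of R Q₁) := ModuleCat.projective_of_free (Module.Free.chooseBasis R Q₁)
  have hp0 : Projective (ModuleCat.of R Q₀) := ModuleCat.projective_of_free (Module.Free.chooseBasis R Q₀)
  let d : ModuleCat.of R Q₁ ⟶ ModuleCat.of R Q₀ := ModuleCat.ofHom β
  obtain ⟨P, hP⟩ := exists_res d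
  -- abstract form of the resolution
  obtain ⟨X₂, X₃, d₂, d₃, hd2, hd3, t1, t2⟩ : ∃ (X₂ X₃ : ModuleCat.{0} R) (d₂ : X₂ →ₗ[R] Q₁)
      (d₃ : X₃ →ₗ[R] X₂), Function.Exact d₂ β ∧ Function.Exact d₃ d₂ ∧
      (Function.Exact (d₂.lTensor N) (β.lTensor N) → Subsingleton (tor R 1 N (cokernel d))) ∧
      (Subsingleton (tor R 2 N (cokernel d)) → Function.Exact (d₃.lTensor N) (d₂.lTensor N)) := by
    have e1 := resComplex_exactAt d 0
    have e2 := resComplex_exactAt d 1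
    rw [HomologicalComplex.exactAt_iff' _ 2 1 0 (by simp) (by simp),
      ShortComplex.ShortExact.moduleCat_exact_iff_function_exact] at e1
    rw [HomologicalComplex.exactAt_iff' _ 3 2 1 (by simp) (by simp),
      ShortComplex.ShortExact.moduleCat_exact_iff_function_exact] at e2
    have t1 := (tor_iff N P 0).2
    have t2 := (tor_iff N P 1).1
    rw [hP] at t1 t2
    have hd : ((resComplex d).d 1 0).hom = β := by rw [resComplex_d]; rfl
    refine ⟨(resComplex d).X 2, (resComplex d).X 3, ((resComplex d).d 2 1).hom,
      ((resComplex d).d 3 2).hom, ?_, e2, ?_, t2⟩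
    · rw [← hd]; exact e1
    · rw [← hd]; exact t1
  let K := LinearMap.ker β
  let α' : A →ₗ[R] K := α.codRestrict K (fun a => by
    have := LinearMap.congr_fun h0 a; simpa [K] using this)
  let ι : K →ₗ[R] Q₁ := K.subtype
  let δ : X₂ →ₗ[R] K := d₂.codRestrict K (fun a => hd2.apply_apply_eq_zero a)
  have hα : ι ∘ₗ α' = α := by ext; rfl
  have hδ : ι ∘ₗ δ = d₂ := by ext; rfl
  have hδs : Function.Surjective δ := by
    rintro ⟨y, hy⟩
    obtain ⟨x, hx⟩ := (hd2 y).1 hy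
    exact ⟨x, Subtype.ext hx⟩
  have hδe : Function.Exact d₃ δ := by
    intro x
    rw [← hd3 x, ← hδ]
    simp [ι]
  have hδs' := LinearMap.lTensor_surjective N hδs
  -- Tor_1 = 0
  have T1 : Subsingleton (tor R 1 N (cokernel d)) := by
    refine t1 fun y => ⟨fun hy => ?_, ?_⟩
    · obtain ⟨a, rfl⟩ := (hex y).1 hy
      obtain ⟨z, hz⟩ := hδs' (α'.lTensor N a)
      refine ⟨z, ?_⟩
      rw [← hδ, ← hα, LinearMap.lTensor_comp, LinearMap.lTensor_comp, LinearMap.comp_apply, hz]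
      rfl
    · rintro ⟨z, rfl⟩
      rw [← LinearMap.comp_apply, ← LinearMap.lTensor_comp, hd2.linearMap_comp_eq_zero]
      simp
  have hfin : Module.Finite R (cokernel d : ModuleCat.{0} R) :=
    Module.Finite.of_surjective (cokernel.π d).hom
      ((ModuleCat.epi_iff_surjective (cokernel.π d)).1 inferInstance)
  have T2 := t2 (hrig _ hfin 1 le_rfl T1)
  have hinj : Function.Injective (ι.lTensor N) := by
    rw [injective_iff_map_eq_zero]
    intro z hz
    obtain ⟨x, rfl⟩ := hδs' z
    rw [← LinearMap.comp_apply, ← LinearMap.lTensor_comp, hδ] at hz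
    exact ((lTensor_exact N hδe hδs) x).2 ((T2 x).1 hz)
  have hsurj : Function.Surjective (α'.lTensor N) := by
    intro z
    have : β.lTensor N (ι.lTensor N z) = 0 := by
      rw [← LinearMap.comp_apply, ← LinearMap.lTensor_comp]
      have : β ∘ₗ ι = 0 := by ext x; exact x.2
      simp [this]
    obtain ⟨a, ha⟩ := (hex _).1 this
    refine ⟨a, hinj ?_⟩
    rw [← ha, ← LinearMap.comp_apply, ← LinearMap.lTensor_comp, hα]
  have hsub : Subsingleton (K ⧸ LinearMap.range α') := by
    refine subsingleton_of_tensor (R := R) N _ (subsingleton_of_forall_eq 0 fun w => ?_)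
    obtain ⟨z, rfl⟩ := LinearMap.lTensor_surjective N
      (Submodule.mkQ_surjective (LinearMap.range α')) w
    obtain ⟨a, rfl⟩ := hsurj z
    rw [← LinearMap.comp_apply, ← LinearMap.lTensor_comp, LinearMap.range_mkQ_comp]
    simp
  rw [Submodule.Quotient.subsingleton_iff, LinearMap.range_eq_top] at hsub
  intro y
  constructor
  · intro hy
    obtain ⟨a, ha⟩ := hsub ⟨y, hy⟩
    exact ⟨a, congrArg Subtype.val ha⟩
  · rintro ⟨a, rfl⟩
    exact LinearMap.congr_fun h0 a

open TensorProduct in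
lemma dualTensor_nat (N : Type) [AddCommGroup N] [Module R N] {P Q : Type} [AddCommGroup P]
    [Module R P] [AddCommGroup Q] [Module R Q] (f : P →ₗ[R] Q)
    (x : N ⊗[R] Module.Dual R Q) :
    dualTensorHom R P N (TensorProduct.comm R N _ (f.dualMap.lTensor N x)) =
      (dualTensorHom R Q N (TensorProduct.comm R N _ x)) ∘ₗ f := by
  induction x with
  | zero => simp
  | tmul n φ => ext; simp
  | add x y hx hy => simp only [map_add, hx, hy, LinearMap.add_comp]

/-- the Hom version of `core`. -/
lemma core_hom [IsNoetherianRing R] [IsLocalRing R]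
    (N : ModuleCat.{0} R) [Module.Finite R N] (hN : Nontrivial N) (hrig : TorRigid R N)
    {P₀ P₁ P₂ : Type} [AddCommGroup P₀] [Module R P₀] [AddCommGroup P₁] [Module R P₁]
    [AddCommGroup P₂] [Module R P₂] [Module.Finite R P₀] [Module.Finite R P₁] [Module.Finite R P₂]
    [Module.Free R P₀] [Module.Free R P₁] [Module.Free R P₂]
    (d₁ : P₁ →ₗ[R] P₀) (d₂ : P₂ →ₗ[R] P₁) (h0 : d₁ ∘ₗ d₂ = 0)
    (hex : ∀ f : P₁ →ₗ[R] N, f ∘ₗ d₂ = 0 → ∃ g : P₀ →ₗ[R] N, g ∘ₗ d₁ = f) :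
    ∀ f : P₁ →ₗ[R] R, f ∘ₗ d₂ = 0 → ∃ g : P₀ →ₗ[R] R, g ∘ₗ d₁ = f := by
  have h00 : d₂.dualMap ∘ₗ d₁.dualMap = 0 := by
    ext φ x
    have := LinearMap.congr_fun h0 x
    simp only [LinearMap.comp_apply, LinearMap.zero_apply] at this
    simp [this]
  have key := core N hN hrig d₁.dualMap d₂.dualMap h00 (by
    intro x
    constructor
    · intro hx
      have h1 := dualTensor_nat N d₂ x
      rw [hx, map_zero, map_zero] at h1
      obtain ⟨g, hg⟩ := hex _ h1.symm
      obtain ⟨y', rfl⟩ := (dualTensorHomEquiv R P₀ N).surjective g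
      obtain ⟨y, rfl⟩ := (TensorProduct.comm R N (Module.Dual R P₀)).surjective y'
      refine ⟨y, ?_⟩
      apply (TensorProduct.comm R N (Module.Dual R P₁)).injective
      apply (dualTensorHomEquiv R P₁ N).injective
      have h2 := dualTensor_nat N d₁ y
      exact h2.trans hg
    · rintro ⟨y, rfl⟩
      rw [← LinearMap.comp_apply, ← LinearMap.lTensor_comp, h00]
      simp)
  intro f hf
  obtain ⟨g, hg⟩ := (key f).1 hf
  exact ⟨g, hg⟩

lemma ext_succ_iff (M : ModuleCat.{0} R) {S : ShortComplex (ModuleCat.{0} R)} (hS : S.ShortExact)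
    [Projective S.X₂] (n : ℕ) :
    Subsingleton (Abelian.Ext.{0} S.X₃ M (n + 2)) ↔ Subsingleton (Abelian.Ext.{0} S.X₁ M (n + 1)) := by
  constructor
  · intro h
    refine subsingleton_of_forall_eq 0 fun x => ?_
    obtain ⟨y, rfl⟩ := Ext.contravariant_sequence_exact₁ hS M x (n₁ := n + 2) (by omega)
      (Subsingleton.elim _ _)
    rw [Ext.eq_zero_of_projective y, Ext.comp_zero]
  · intro h
    refine subsingleton_of_forall_eq 0 fun x => ?_
    obtain ⟨y, rfl⟩ := Ext.contravariant_sequence_exact₃ hS M x (n₀ := n + 1)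
      (Ext.eq_zero_of_projective _) (by omega)
    rw [Subsingleton.elim y 0, Ext.comp_zero]

lemma ext_one_iff (M : ModuleCat.{0} R) {S : ShortComplex (ModuleCat.{0} R)} (hS : S.ShortExact)
    [Projective S.X₂] :
    Subsingleton (Abelian.Ext.{0} S.X₃ M 1) ↔ ∀ f : S.X₁ ⟶ M, ∃ g : S.X₂ ⟶ M, S.f ≫ g = f := by
  constructor
  · intro h f
    obtain ⟨y, hy⟩ := Ext.contravariant_sequence_exact₁ hS M (Ext.mk₀ f) (n₁ := 1) (by omega)
      (Subsingleton.elim _ _)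
    obtain ⟨g, rfl⟩ := Ext.mk₀_bijective _ _ |>.2 y
    rw [Ext.mk₀_comp_mk₀] at hy
    exact ⟨g, (Ext.mk₀_bijective _ _).1 hy⟩
  · intro h
    refine subsingleton_of_forall_eq 0 fun x => ?_
    obtain ⟨y, rfl⟩ := Ext.contravariant_sequence_exact₃ hS M x (n₀ := 0)
      (Ext.eq_zero_of_projective _) (by omega)
    obtain ⟨f, rfl⟩ := Ext.mk₀_bijective _ _ |>.2 y
    obtain ⟨g, rfl⟩ := h f
    rw [← Ext.mk₀_comp_mk₀, hS.extClass_comp_assoc]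

lemma ext_transfer [IsNoetherianRing R] [IsLocalRing R]
    (N : ModuleCat.{0} R) [Module.Finite R N] (hN : Nontrivial N) (hrig : TorRigid R N) (n : ℕ) :
    ∀ (X : ModuleCat.{0} R) [Module.Finite R X], Subsingleton (Abelian.Ext.{0} X N (n + 1)) →
      Subsingleton (Abelian.Ext.{0} X (ModuleCat.of R R) (n + 1)) := by
  induction n with
  | zero =>
    intro X _ h
    obtain ⟨F, _, _, _, _, p, hp⟩ := Module.exists_finite_presentation R X
    have hS := LinearMap.shortExact_shortComplexKer hp
    have hproj : Projective p.shortComplexKer.X₂ :=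
      ModuleCat.projective_of_free (Module.Free.chooseBasis R F)
    have h' := (ext_one_iff N hS).1 h
    refine (ext_one_iff _ hS).2 ?_
    obtain ⟨F₁, _, _, _, _, p₁, hp₁⟩ := Module.exists_finite_presentation R (LinearMap.ker p)
    obtain ⟨F₂, _, _, _, _, p₂, hp₂⟩ := Module.exists_finite_presentation R (LinearMap.ker p₁)
    have hz : p₁ ∘ₗ ((LinearMap.ker p₁).subtype ∘ₗ p₂) = 0 := by
      ext x
      exact congrArg _ (p₂ x).2
    have desc : ∀ {M : Type} [AddCommGroup M] [Module R M] (f : F₁ →ₗ[R] M),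
        f ∘ₗ ((LinearMap.ker p₁).subtype ∘ₗ p₂) = 0 → ∃ g : LinearMap.ker p →ₗ[R] M,
          g ∘ₗ p₁ = f := by
      intro M _ _ f hf
      have hk : LinearMap.ker p₁ ≤ LinearMap.ker f := by
        intro x hx
        obtain ⟨y, hy⟩ := hp₂ ⟨x, hx⟩
        have := LinearMap.congr_fun hf y
        simpa [hy] using this
      refine ⟨(LinearMap.ker p₁).liftQ f hk ∘ₗ
        (p₁.quotKerEquivOfSurjective hp₁).symm.toLinearMap, ?_⟩
      ext x
      have : (p₁.quotKerEquivOfSurjective hp₁).symm (p₁ x) = Submodule.Quotient.mk x := by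
        rw [LinearEquiv.symm_apply_eq]; rfl
      simp [this]
    have key := core_hom N hN hrig ((LinearMap.ker p).subtype ∘ₗ p₁)
      ((LinearMap.ker p₁).subtype ∘ₗ p₂) (by rw [LinearMap.comp_assoc, hz, LinearMap.comp_zero])
      (by
        intro f hf
        obtain ⟨g, rfl⟩ := desc f hf
        obtain ⟨g', hg'⟩ := h' (ModuleCat.ofHom g)
        refine ⟨g'.hom, ?_⟩
        rw [← LinearMap.comp_assoc]
        congr 1
        exact congrArg ModuleCat.Hom.hom hg')
    intro f
    obtain ⟨g, hg⟩ := key (f.hom ∘ₗ p₁) (by rw [LinearMap.comp_assoc, hz, LinearMap.comp_zero])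
    refine ⟨ModuleCat.ofHom g, ?_⟩
    ext x
    obtain ⟨y, rfl⟩ := hp₁ x
    exact LinearMap.congr_fun hg y
  | succ n ih =>
    intro X _ h
    obtain ⟨F, _, _, _, _, p, hp⟩ := Module.exists_finite_presentation R X
    have hS := LinearMap.shortExact_shortComplexKer hp
    have hproj : Projective p.shortComplexKer.X₂ :=
      ModuleCat.projective_of_free (Module.Free.chooseBasis R F)
    have hf : Module.Finite R p.shortComplexKer.X₁ :=
      inferInstanceAs (Module.Finite R (LinearMap.ker p))
    exact (ext_succ_iff _ hS n).2 (ih _ ((ext_succ_iff N hS n).1 h))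

lemma injDim_of_cyclic (n : ℕ) : ∀ (M : ModuleCat.{0} R),
    (∀ I : Ideal R, Subsingleton (Abelian.Ext.{0} (ModuleCat.of R (R ⧸ I)) M (n + 1))) →
      HasInjectiveDimensionLT M (n + 1) := by
  induction n with
  | zero =>
    intro M h
    refine injective_iff_hasInjectiveDimensionLT_one.1 ?_
    rw [← Module.injective_iff_injective_object R M, ← Module.Baer.iff_injective]
    intro I g
    let S : ShortComplex (ModuleCat.{0} R) :=
      ShortComplex.mk (ModuleCat.ofHom I.subtype) (ModuleCat.ofHom I.mkQ) (by
        ext x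
        exact Ideal.Quotient.eq_zero_iff_mem.2 x.2)
    have hS : S.ShortExact := ModuleCat.shortComplex_shortExact S
      (LinearMap.exact_subtype_mkQ I) I.injective_subtype I.mkQ_surjective
    have hproj : Projective S.X₂ :=
      ModuleCat.projective_of_free (Module.Free.chooseBasis R R)
    obtain ⟨g', hg'⟩ := (ext_one_iff M hS).1 (h I) (ModuleCat.ofHom g)
    refine ⟨g'.hom, fun x mem => ?_⟩
    exact LinearMap.congr_fun (congrArg ModuleCat.Hom.hom hg') ⟨x, mem⟩
  | succ n ih =>
    intro M h
    obtain ⟨E, inj, f, monof⟩ := EnoughInjectives.presentation M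
    let T := ShortComplex.mk f (cokernel.π f) (cokernel.condition f)
    have hT : T.ShortExact := { exact := ShortComplex.exact_cokernel f }
    refine (hT.hasInjectiveDimensionLT_X₃_iff n inj).1 (ih _ fun I => ?_)
    refine subsingleton_of_forall_eq 0 fun x => ?_
    obtain ⟨y, rfl⟩ := Ext.covariant_sequence_exact₃ _ hT x (n₁ := n + 2) rfl (by
      have := h I
      exact Subsingleton.elim (α := Abelian.Ext.{0} (ModuleCat.of R (R ⧸ I)) M (n + 2)) _ _)
    have hy : y = 0 := Ext.eq_zero_of_injective (I := E) y
    rw [hy, Ext.zero_comp]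

end aux

/-- a nonzero f.g. Tor-rigid module of finite injective dimension
forces the ring to be Gorenstein (i.e. `injDim R R < ∞`). -/
theorem stmt1 [IsNoetherianRing R] [IsLocalRing R]
    (N : ModuleCat R) [Module.Finite R N] (hN : Nontrivial N)
    (hrig : TorRigid R N) (hid : injDim R N < ⊤) :
    injDim R (ModuleCat.of R R) < ⊤ := by
  obtain ⟨a, ha, hlt⟩ := sInf_lt_iff.1 hid
  lift a to ℕ using hlt.ne
  have h1 : HasInjectiveDimensionLT (ModuleCat.of R R) (a + 1) := by
    refine injDim_of_cyclic a _ fun I => ?_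
    refine ext_transfer N hN hrig a _ ?_
    rw [← ext_bridge]
    exact ha (a + 1) _ (by exact_mod_cast Nat.lt_succ_self a)
  refine lt_of_le_of_lt (sInf_le (a := (a : ℕ∞)) ?_) (ENat.natCast_lt_top a)
  intro i X hi
  have hi' : a < i := by exact_mod_cast hi
  obtain ⟨j, rfl⟩ : ∃ j, i = j + 1 := ⟨i - 1, by omega⟩
  rw [ext_bridge]
  exact HasInjectiveDimensionLT.subsingleton _ (a + 1) (j + 1) hi' X
end
end

section
/- Let (R, m) be a commutative Noetherian local ring. If R admits a nonzero finitely generated maximal Cohen-Macaulay Tor-rigid module M, then R is Cohen-Macaulay. -/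
open CategoryTheory

noncomputable section

variable (R : Type) [CommRing R]

open IsLocalRing RingTheory.Sequence

lemma aux_ext_iff (n : ℕ) (X Y : ModuleCat R) (P : ProjectiveResolution X) :
    Subsingleton (ext R (n+1) X Y) ↔
      ∀ f : P.complex.X (n+1) ⟶ Y, P.complex.d (n+2) (n+1) ≫ f = 0 →
        ∃ g : P.complex.X n ⟶ Y, P.complex.d (n+1) n ≫ g = f := by
  rw [← ModuleCat.isZero_iff_subsingleton, (P.isoExt (R := R) (n+1) Y).isZero_iff,
    ← HomologicalComplex.exactAt_iff_isZero_homology,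
    HomologicalComplex.exactAt_iff' _ n (n+1) (n+2) (by simp) (by simp),
    ShortComplex.moduleCat_exact_iff]
  rfl

lemma aux_ext_zero_iff (X Y : ModuleCat R) (P : ProjectiveResolution X) :
    Subsingleton (ext R 0 X Y) ↔
      ∀ f : P.complex.X 0 ⟶ Y, P.complex.d 1 0 ≫ f = 0 → f = 0 := by
  rw [← ModuleCat.isZero_iff_subsingleton, (P.isoExt (R := R) 0 Y).isZero_iff,
    ← HomologicalComplex.exactAt_iff_isZero_homology,
    HomologicalComplex.exactAt_iff' _ 0 0 1 (by simp) (by simp),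
    ShortComplex.moduleCat_exact_iff]
  have : P.complex.d 0 0 = 0 := P.complex.shape _ _ (by simp)
  constructor
  · intro h f hf
    obtain ⟨g, hg⟩ := h f hf
    have hg' : P.complex.d 0 0 ≫ g = f := hg
    rw [this] at hg'
    exact hg'.symm.trans Limits.zero_comp
  · intro h f hf
    exact ⟨0, by rw [map_zero]; exact (h f hf).symm⟩

lemma aux_ext_eq (n : ℕ) (X Y : ModuleCat R) :
    Subsingleton (ext R n X Y) ↔ Subsingleton (Abelian.Ext X Y n) := by
  let P := projectiveResolution X
  cases n with
  | zero =>
    rw [aux_ext_zero_iff R X Y P, Abelian.Ext.addEquiv₀.subsingleton_congr]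
    constructor
    · intro h
      refine ⟨fun a b => ?_⟩
      have := fun a : X ⟶ Y => h (P.π.f 0 ≫ a) (by
        exact (Category.assoc _ _ _).symm.trans
          ((congrArg (· ≫ a) P.complex_d_comp_π_f_zero).trans Limits.zero_comp))
      have h2 := fun a : X ⟶ Y => (cancel_epi (P.π.f 0)).1 ((this a).trans (Limits.comp_zero).symm)
      rw [h2 a, h2 b]
    · intro h f hf
      have hex := P.exact₀
      have e : P.π.f 0 ≫ hex.desc f hf = f := hex.g_desc f hf
      rw [← e]
      have : hex.desc f hf = 0 := Subsingleton.elim (α := (X ⟶ Y)) _ _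
      rw [this, Limits.comp_zero]
  | succ n =>
    rw [aux_ext_iff R n X Y P]
    constructor
    · intro h
      refine subsingleton_of_forall_eq 0 fun a => ?_
      obtain ⟨f, hf, rfl⟩ := P.extMk_surjective a (n+2) rfl
      exact (P.extMk_eq_zero_iff f _ rfl hf n rfl).2 (h f hf)
    · intro h f hf
      exact (P.extMk_eq_zero_iff f _ rfl hf n rfl).1 (Subsingleton.elim _ _)

lemma aux_depth_iff [IsNoetherianRing R] [IsLocalRing R] (N : ModuleCat R) [Module.Finite R N]
    [Nontrivial N] (n : ℕ) :
    (n : ℕ∞) ≤ depth R N ↔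
      ∃ rs : List R, rs.length = n ∧ (∀ r ∈ rs, r ∈ maximalIdeal R) ∧ IsRegular N rs := by
  have h1 : (n : ℕ∞) ≤ depth R N ↔
      ∀ i < n, Subsingleton (Abelian.Ext (ModuleCat.of R (ResidueField R)) N i) := by
    simp only [depth, le_sInf_iff, Set.mem_ofPred_eq, ← aux_ext_eq]
    constructor
    · intro h i hi
      by_contra hc
      have := h i ⟨i, rfl, hc⟩
      norm_cast at this
      omega
    · rintro h _ ⟨i, rfl, hi⟩
      by_contra hc
      exact hi (h i (by norm_cast at hc; omega))
  have lt : maximalIdeal R • (⊤ : Submodule R N) < ⊤ :=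
    (Submodule.top_ne_ideal_smul_of_le_jacobson_annihilator
      (maximalIdeal_le_jacobson _)).symm.lt_top
  have supp : Module.support R (ResidueField R) = PrimeSpectrum.zeroLocus (maximalIdeal R) := by
    have : Module.support R (R ⧸ maximalIdeal R) = PrimeSpectrum.zeroLocus (maximalIdeal R) := by
      rw [Module.support_eq_zeroLocus, Ideal.annihilator_quotient]
    exact this
  have fin : Module.Finite R (ModuleCat.of R (ResidueField R)) :=
    inferInstanceAs (Module.Finite R (R ⧸ maximalIdeal R))
  rw [h1]
  constructor
  · exact ModuleCat.exists_isRegular_of_exists_subsingleton_ext _ n N lt _ supp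
  · rintro ⟨rs, rfl, hm, hr⟩
    exact ModuleCat.subsingleton_ext_of_exists_isRegular _ _ supp.subset N lt rs hm hr

lemma aux_final [IsNoetherianRing R] [IsLocalRing R]
    (M : ModuleCat R) [Module.Finite R M] (hM : Nontrivial M)
    (key : ∀ rs : List R, (∀ r ∈ rs, r ∈ maximalIdeal R) → IsRegular M rs → IsRegular R rs)
    (hmcm : (depth R M : WithBot ℕ∞) = ringKrullDim R) :
    (depth R (ModuleCat.of R R) : WithBot ℕ∞) = ringKrullDim R := by
  have h1 : depth R M ≤ depth R (ModuleCat.of R R) := by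
    refine ENat.forall_natCast_le_iff_le.1 fun n hn => ?_
    obtain ⟨rs, hl, hm, hr⟩ := (aux_depth_iff R M n).1 hn
    exact (aux_depth_iff R (ModuleCat.of R R) n).2 ⟨rs, hl, hm, key rs hm hr⟩
  have h2 : depth R (ModuleCat.of R R) ≤ depth R M := by
    refine ENat.forall_natCast_le_iff_le.1 fun n hn => ?_
    obtain ⟨rs, hl, hm, hr⟩ := (aux_depth_iff R (ModuleCat.of R R) n).1 hn
    have := ringKrullDim_add_length_eq_ringKrullDim_of_isRegular rs hr
    rw [← hmcm, hl] at this
    have hnt : Nontrivial (R ⧸ Ideal.ofList rs) := by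
      refine Ideal.Quotient.nontrivial_iff.2 fun h => hr.top_ne_smul ?_
      rw [h]; simp
    have h0 : (0 : WithBot ℕ∞) ≤ ringKrullDim (R ⧸ Ideal.ofList rs) := ringKrullDim_nonneg_of_nontrivial
    have h3 : ((n : ℕ∞) : WithBot ℕ∞) ≤ (depth R M : WithBot ℕ∞) := by
      rw [← this]
      exact le_add_of_nonneg_left h0
    exact WithBot.coe_le_coe.1 h3
  rw [← hmcm, le_antisymm h1 h2]


lemma aux_tor_iff (n : ℕ) (M X : ModuleCat R) (P : ProjectiveResolution X) :
    Subsingleton (tor R (n+1) M X) ↔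
      Function.Exact (LinearMap.lTensor M (P.complex.d (n+2) (n+1)).hom)
        (LinearMap.lTensor M (P.complex.d (n+1) n).hom) := by
  rw [← ModuleCat.isZero_iff_subsingleton]
  refine (P.isoLeftDerivedObj
    ((MonoidalCategory.tensoringLeft (ModuleCat R)).obj M) (n+1)).isZero_iff.trans ?_
  erw [← HomologicalComplex.exactAt_iff_isZero_homology]
  rw [
    HomologicalComplex.exactAt_iff' _ (n+2) (n+1) n (by simp) (by simp),
    ShortComplex.ShortExact.moduleCat_exact_iff_function_exact]
  rfl

/-- Elementary vanishing of the first Tor. -/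
def AuxT (M X : Type) [AddCommGroup M] [Module R M] [AddCommGroup X] [Module R X] : Prop :=
  ∀ (A B : Type) [AddCommGroup A] [Module R A] [AddCommGroup B] [Module R B]
    (f : A →ₗ[R] B) (g : B →ₗ[R] X), Function.Injective f → Function.Exact f g →
    Function.Surjective g → Function.Injective (LinearMap.lTensor M f)

lemma auxT_of_proj (M X A B : Type) [AddCommGroup M] [Module R M] [AddCommGroup X] [Module R X]
    [AddCommGroup A] [Module R A] [AddCommGroup B] [Module R B] [Module.Projective R B]
    (f : A →ₗ[R] B) (g : B →ₗ[R] X) (hf : Function.Injective f) (hfg : Function.Exact f g)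
    (hg : Function.Surjective g) (hinj : Function.Injective (LinearMap.lTensor M f)) :
    AuxT R M X := by
  intro A' B' _ _ _ _ f' g' hf' hfg' hg'
  obtain ⟨φ, hφ⟩ := Module.projective_lifting_property g' g hg'
  have h1 : ∀ a, φ (f a) ∈ LinearMap.range f' := fun a => by
    apply (hfg' _).1
    have := LinearMap.congr_fun hφ (f a)
    simp only [LinearMap.comp_apply] at this
    rw [this, hfg.apply_apply_eq_zero]
  let ψ : A →ₗ[R] A' := (LinearEquiv.ofInjective f' hf').symm.toLinearMap ∘ₗ
    LinearMap.codRestrict (LinearMap.range f') (φ ∘ₗ f) h1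
  have hψ : ∀ a, f' (ψ a) = φ (f a) := fun a => by
    have := (LinearEquiv.ofInjective f' hf').apply_symm_apply ⟨φ (f a), h1 a⟩
    exact congrArg Subtype.val this
  let u : A →ₗ[R] B × A' := LinearMap.prod f (-ψ)
  let v : B × A' →ₗ[R] B' := LinearMap.coprod φ f'
  have huv : Function.Exact u v := by
    rintro ⟨b, a'⟩
    have hv : v (b, a') = φ b + f' a' := rfl
    have hu : ∀ a, u a = (f a, - ψ a) := fun a => rfl
    simp only [hv, Set.mem_range, hu, Prod.mk.injEq]
    constructor
    · intro h
      have hb : g b = 0 := by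
        have := congrArg g' h
        rw [map_add, hfg'.apply_apply_eq_zero, add_zero, map_zero] at this
        rw [← hφ]; exact this
      obtain ⟨a, rfl⟩ := (hfg _).1 hb
      refine ⟨a, rfl, hf' ?_⟩
      rw [map_neg, hψ]
      exact (eq_neg_of_add_eq_zero_right h).symm
    · rintro ⟨a, rfl, rfl⟩
      rw [map_neg, hψ, add_neg_cancel]
  have hv : Function.Surjective v := by
    intro b'
    obtain ⟨b, hb⟩ := hg (g' b')
    obtain ⟨a', ha'⟩ := (hfg' (b' - φ b)).1 (by
      rw [map_sub, ← hb, ← hφ]; exact sub_self _)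
    refine ⟨(b, a'), ?_⟩
    simp [v, ha']
  have hex := lTensor_exact M huv hv
  rw [← LinearMap.ker_eq_bot, LinearMap.ker_eq_bot']
  intro z hz
  have h2 : LinearMap.lTensor M v (LinearMap.lTensor M (LinearMap.inr R B A') z) = 0 := by
    rw [← LinearMap.comp_apply, ← LinearMap.lTensor_comp]
    simpa [v] using hz
  obtain ⟨w, hw⟩ := (hex _).1 h2
  have h3 : LinearMap.lTensor M f w = 0 := by
    have := congrArg (LinearMap.lTensor M (LinearMap.fst R B A')) hw
    rw [← LinearMap.comp_apply, ← LinearMap.comp_apply, ← LinearMap.lTensor_comp,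
      ← LinearMap.lTensor_comp] at this
    simpa [u] using this
  have hw0 : w = 0 := hinj (by rw [h3, map_zero])
  have := congrArg (LinearMap.lTensor M (LinearMap.snd R B A')) hw
  rw [hw0, map_zero, map_zero, ← LinearMap.comp_apply, ← LinearMap.lTensor_comp] at this
  simpa using this.symm

lemma aux_lTensor_exact (M A B C : Type) [AddCommGroup M] [Module R M] [AddCommGroup C] [Module R C]
    [AddCommGroup A] [Module R A] [AddCommGroup B] [Module R B]
    (f : A →ₗ[R] B) (g : B →ₗ[R] C) (hfg : Function.Exact f g)
    (hg : Function.Surjective g) :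
    Function.Exact (LinearMap.lTensor M f) (LinearMap.lTensor M g) := lTensor_exact M hfg hg

/-- `A → B → C` exact, Tor vanishes on `B` and `M ⊗ A → M ⊗ B` injective. -/
lemma auxT_third (M A B C : Type) [AddCommGroup M] [Module R M] [AddCommGroup C] [Module R C]
    [AddCommGroup A] [Module R A] [AddCommGroup B] [Module R B]
    (f : A →ₗ[R] B) (g : B →ₗ[R] C) (hfg : Function.Exact f g)
    (hf : Function.Injective f)
    (hg : Function.Surjective g) (hinj : Function.Injective (LinearMap.lTensor M f))
    (hB : AuxT R M B) : AuxT R M C := by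
  let F := B →₀ R
  let p : F →ₗ[R] B := Finsupp.linearCombination R id
  have hp : Function.Surjective p := Finsupp.linearCombination_id_surjective R B
  let KB := LinearMap.ker p
  let KC := LinearMap.ker (g ∘ₗ p)
  have hle : KB ≤ KC := LinearMap.ker_le_ker_comp _ _
  refine auxT_of_proj R M C KC F KC.subtype (g ∘ₗ p) KC.injective_subtype
    (LinearMap.exact_subtype_ker_map _) (hg.comp hp) ?_
  have h1 : ∀ k : KC, p k ∈ LinearMap.range f := fun k => (hfg _).1 k.2
  let ψ : KC →ₗ[R] A := (LinearEquiv.ofInjective f hf).symm.toLinearMap ∘ₗ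
    LinearMap.codRestrict (LinearMap.range f) (p ∘ₗ KC.subtype) h1
  have hψ : ∀ a, f (ψ a) = p a := fun a => by
    have := (LinearEquiv.ofInjective f hf).apply_symm_apply ⟨p a, h1 a⟩
    exact congrArg Subtype.val this
  have hψs : Function.Surjective ψ := by
    intro a
    obtain ⟨b, hb⟩ := hp (f a)
    refine ⟨⟨b, ?_⟩, hf ?_⟩
    · change g (p b) = 0
      rw [hb, hfg.apply_apply_eq_zero]
    · rw [hψ]; exact hb
  have hexψ : Function.Exact (Submodule.inclusion hle) ψ := by
    intro k
    constructor
    · intro hk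
      refine ⟨⟨k, ?_⟩, rfl⟩
      change p k = 0
      rw [← hψ, hk, map_zero]
    · rintro ⟨k, rfl⟩
      apply hf
      rw [hψ, map_zero]
      exact k.2
  have hex := aux_lTensor_exact R M KB KC A (Submodule.inclusion hle) ψ hexψ hψs
  have hBi := hB KB F KB.subtype p KB.injective_subtype (LinearMap.exact_subtype_ker_map _) hp
  rw [← LinearMap.ker_eq_bot, LinearMap.ker_eq_bot']
  intro z hz
  have h2 : LinearMap.lTensor M ψ z = 0 := by
    apply hinj
    rw [map_zero, ← LinearMap.comp_apply, ← LinearMap.lTensor_comp]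
    have : f ∘ₗ ψ = p ∘ₗ KC.subtype := LinearMap.ext hψ
    rw [this, LinearMap.lTensor_comp, LinearMap.comp_apply, hz, map_zero]
  obtain ⟨w, rfl⟩ := (hex _).1 h2
  rw [← LinearMap.comp_apply, ← LinearMap.lTensor_comp] at hz
  have : w = 0 := hBi (by rw [map_zero]; exact hz)
  rw [this, map_zero]

lemma auxT_proj (M X : Type) [AddCommGroup M] [Module R M] [AddCommGroup X] [Module R X]
    [Module.Projective R X] : AuxT R M X := by
  refine auxT_of_proj R M X PUnit X 0 LinearMap.id (fun _ _ _ => rfl) ?_ Function.surjective_id ?_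
  · intro x
    simpa using eq_comm
  · exact fun _ _ _ => Subsingleton.elim _ _

lemma aux_tor_one (M X : ModuleCat R) : Subsingleton (tor R 1 M X) ↔ AuxT R M X := by
  let P := projectiveResolution X
  rw [aux_tor_iff R 0 M X P]
  let d1 := (P.complex.d 1 0).hom
  let d2 := (P.complex.d 2 1).hom
  let p : P.complex.X 0 →ₗ[R] X := (P.π.f 0).hom
  have hp : Function.Surjective p := (ModuleCat.epi_iff_surjective _).1 inferInstance
  have e0 : Function.Exact d1 p :=
    (ShortComplex.ShortExact.moduleCat_exact_iff_function_exact _).1 P.exact₀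
  have e1 : Function.Exact d2 d1 := 
    (ShortComplex.ShortExact.moduleCat_exact_iff_function_exact _).1 (P.exact_succ 0)
  change Function.Exact (d2.lTensor M) (d1.lTensor M) ↔ _
  have : Module.Projective R (P.complex.X 0) :=
    (IsProjective.iff_projective _).2 (P.projective 0)
  let K := LinearMap.range d1
  let q : P.complex.X 1 →ₗ[R] K := d1.rangeRestrict
  have hq : Function.Surjective q := d1.surjective_rangeRestrict
  have eq : Function.Exact d2 q := by
    intro x
    rw [← e1 x]
    exact ⟨fun h => congrArg Subtype.val h, fun h => Subtype.ext h⟩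
  have hd : d1 = K.subtype ∘ₗ q := rfl
  have eK : Function.Exact K.subtype p := by
    intro x
    rw [e0 x]
    simp [K]
  constructor
  · intro h
    refine auxT_of_proj R M X K _ K.subtype p K.injective_subtype eK hp ?_
    rw [← LinearMap.ker_eq_bot, LinearMap.ker_eq_bot']
    intro z hz
    obtain ⟨y, rfl⟩ := LinearMap.lTensor_surjective M hq z
    rw [← LinearMap.comp_apply, ← LinearMap.lTensor_comp, ← hd] at hz
    obtain ⟨w, rfl⟩ := (h _).1 hz
    exact (lTensor_exact M eq hq).apply_apply_eq_zero w
  · intro h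
    have := h K _ K.subtype p K.injective_subtype eK hp
    intro y
    rw [← lTensor_exact M eq hq y, hd, LinearMap.lTensor_comp, LinearMap.comp_apply]
    exact ⟨fun h => this (by rw [h, map_zero]), fun h => by rw [h, map_zero]⟩

lemma aux_tor_two_exists (M X : ModuleCat R) (h : Subsingleton (tor R 2 M X)) :
    ∃ (F K : ModuleCat.{0} R) (f : K →ₗ[R] F) (g : F →ₗ[R] X), Module.Projective R F ∧
      Function.Injective f ∧ Function.Exact f g ∧ Function.Surjective g ∧ AuxT R M K := by
  let P := projectiveResolution X
  rw [aux_tor_iff R 1 M X P] at h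
  let d1 := (P.complex.d 1 0).hom
  let d2 := (P.complex.d 2 1).hom
  let d3 := (P.complex.d 3 2).hom
  let p : P.complex.X 0 →ₗ[R] X := (P.π.f 0).hom
  have hp : Function.Surjective p := (ModuleCat.epi_iff_surjective _).1 inferInstance
  have e0 : Function.Exact d1 p :=
    (ShortComplex.ShortExact.moduleCat_exact_iff_function_exact _).1 P.exact₀
  have e1 : Function.Exact d2 d1 := 
    (ShortComplex.ShortExact.moduleCat_exact_iff_function_exact _).1 (P.exact_succ 0)
  have e2 : Function.Exact d3 d2 := 
    (ShortComplex.ShortExact.moduleCat_exact_iff_function_exact _).1 (P.exact_succ 1)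
  change Function.Exact (d3.lTensor M) (d2.lTensor M) at h
  have : Module.Projective R (P.complex.X 0) :=
    (IsProjective.iff_projective _).2 (P.projective 0)
  have : Module.Projective R (P.complex.X 1) :=
    (IsProjective.iff_projective _).2 (P.projective 1)
  let K := LinearMap.range d1
  let q : P.complex.X 1 →ₗ[R] K := d1.rangeRestrict
  have hq : Function.Surjective q := d1.surjective_rangeRestrict
  have eK : Function.Exact K.subtype p := by
    intro x
    rw [e0 x]
    simp [K]
  let L := LinearMap.range d2
  let q2 : P.complex.X 2 →ₗ[R] L := d2.rangeRestrict
  have hq2 : Function.Surjective q2 := d2.surjective_rangeRestrict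
  have eL : Function.Exact L.subtype q := by
    intro x
    have : q x = 0 ↔ d1 x = 0 := ⟨fun h => congrArg Subtype.val h, fun h => Subtype.ext h⟩
    rw [this, e1 x]
    simp [L]
  have hd : d2 = L.subtype ∘ₗ q2 := rfl
  refine ⟨P.complex.X 0, ModuleCat.of R K, K.subtype, p, ‹_›, K.injective_subtype, eK, hp, ?_⟩
  refine auxT_of_proj R M K L _ L.subtype q L.injective_subtype eL hq ?_
  rw [← LinearMap.ker_eq_bot, LinearMap.ker_eq_bot']
  intro z hz
  obtain ⟨y, rfl⟩ := LinearMap.lTensor_surjective M hq2 z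
  rw [← LinearMap.comp_apply, ← LinearMap.lTensor_comp, ← hd] at hz
  obtain ⟨w, rfl⟩ := (h _).1 hz
  rw [← LinearMap.comp_apply, ← LinearMap.lTensor_comp]
  have : q2 ∘ₗ d3 = 0 := LinearMap.ext fun x => Subtype.ext (e2.apply_apply_eq_zero x)
  rw [this]; simp

lemma auxT_retract (M X Y : Type) [AddCommGroup M] [Module R M] [AddCommGroup X] [Module R X]
    [AddCommGroup Y] [Module R Y] (s : X →ₗ[R] Y) (r : Y →ₗ[R] X) (hrs : r ∘ₗ s = LinearMap.id)
    (hY : AuxT R M Y) : AuxT R M X := by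
  intro A B _ _ _ _ f g hf hfg hg
  let d : B × Y →ₗ[R] X := g ∘ₗ LinearMap.fst R B Y - r ∘ₗ LinearMap.snd R B Y
  have hd : ∀ b y, (b, y) ∈ LinearMap.ker d ↔ g b = r y := fun b y => by
    simp [d, LinearMap.mem_ker, sub_eq_zero]
  have hrs' : ∀ x, r (s x) = x := fun x => LinearMap.congr_fun hrs x
  let u : B →ₗ[R] LinearMap.ker d := LinearMap.codRestrict _ (LinearMap.prod LinearMap.id (s ∘ₗ g))
    (fun b => (hd b (s (g b))).2 (hrs' _).symm)
  let q : LinearMap.ker d →ₗ[R] Y := LinearMap.snd R B Y ∘ₗ (LinearMap.ker d).subtype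
  have := hY A (LinearMap.ker d) (u ∘ₗ f) q ?_ ?_ ?_
  · rw [LinearMap.lTensor_comp, LinearMap.coe_comp] at this
    exact this.of_comp
  · intro a b hab
    exact hf (congrArg (fun z => (Subtype.val z).1) hab)
  · rintro ⟨⟨b, y⟩, hy⟩
    constructor
    · intro h
      have h : y = 0 := h
      subst h
      obtain ⟨a, rfl⟩ := (hfg b).1 (by rw [(hd _ _).1 hy, map_zero])
      refine ⟨a, Subtype.ext (Prod.ext rfl ?_)⟩
      change s (g (f a)) = 0
      rw [hfg.apply_apply_eq_zero, map_zero]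
    · rintro ⟨a, ha⟩
      rw [← ha]
      change s (g (f a)) = 0
      rw [hfg.apply_apply_eq_zero, map_zero]
  · intro y
    obtain ⟨b, hb⟩ := hg (r y)
    exact ⟨⟨(b, y), (hd _ _).2 hb⟩, rfl⟩

lemma auxT_prod (M X Y : Type) [AddCommGroup M] [Module R M] [AddCommGroup X] [Module R X]
    [AddCommGroup Y] [Module R Y] [Module.Projective R Y]
    (hX : AuxT R M X) : AuxT R M (X × Y) := by
  let p : (X →₀ R) →ₗ[R] X := Finsupp.linearCombination R id
  have hp : Function.Surjective p := Finsupp.linearCombination_id_surjective R X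
  let K := LinearMap.ker p
  have hi := hX K (X →₀ R) K.subtype p K.injective_subtype (LinearMap.exact_subtype_ker_map _) hp
  refine auxT_of_proj R M (X × Y) K ((X →₀ R) × Y) (LinearMap.inl R _ _ ∘ₗ K.subtype)
    (LinearMap.prodMap p LinearMap.id) ?_ ?_ ?_ ?_
  · exact LinearMap.inl_injective.comp K.injective_subtype
  · rintro ⟨a, y⟩
    constructor
    · intro h
      have h1 : p a = 0 := congrArg Prod.fst h
      have h2 : y = 0 := congrArg Prod.snd h
      subst h2
      exact ⟨⟨a, h1⟩, rfl⟩
    · rintro ⟨k, hk⟩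
      rw [← hk]
      exact Prod.ext k.2 rfl
  · rintro ⟨x, y⟩
    obtain ⟨a, ha⟩ := hp x
    exact ⟨(a, y), Prod.ext ha rfl⟩
  · refine Function.Injective.of_comp (f := LinearMap.lTensor M (LinearMap.fst R (X →₀ R) Y)) ?_
    rw [← LinearMap.coe_comp, ← LinearMap.lTensor_comp]
    exact hi

lemma aux_syzygy_indep (M X F K F' K' : ModuleCat.{0} R)
    (f : K →ₗ[R] F) (g : F →ₗ[R] X) (f' : K' →ₗ[R] F') (g' : F' →ₗ[R] X)
    (hF : Module.Projective R F) (hF' : Module.Projective R F')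
    (hf : Function.Injective f) (hfg : Function.Exact f g) (hg : Function.Surjective g)
    (hf' : Function.Injective f') (hfg' : Function.Exact f' g') (hg' : Function.Surjective g')
    (hK : AuxT R M K) : AuxT R M K' := by
  obtain ⟨φ, hφ⟩ := Module.projective_lifting_property g g' hg
  obtain ⟨ψ, hψ⟩ := Module.projective_lifting_property g' g hg'
  have factor : ∀ {A B : ModuleCat.{0} R} (i : A →ₗ[R] B) (_ : Function.Injective i)
      {C : ModuleCat.{0} R} (u : C →ₗ[R] B) (_ : ∀ c, u c ∈ LinearMap.range i),
      ∃ v : C →ₗ[R] A, i ∘ₗ v = u := by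
    intro A B i hi C u hu
    refine ⟨(LinearEquiv.ofInjective i hi).symm.toLinearMap ∘ₗ
      LinearMap.codRestrict (LinearMap.range i) u hu, LinearMap.ext fun c => ?_⟩
    have := (LinearEquiv.ofInjective i hi).apply_symm_apply ⟨u c, hu c⟩
    exact congrArg Subtype.val this
  obtain ⟨φ', hφ'⟩ := factor f hf (φ ∘ₗ f') (fun c => (hfg _).1 (by
    have := LinearMap.congr_fun hφ (f' c)
    exact this.trans (hfg'.apply_apply_eq_zero c)))
  obtain ⟨ψ', hψ'⟩ := factor f' hf' (ψ ∘ₗ f) (fun c => (hfg' _).1 (by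
    have := LinearMap.congr_fun hψ (f c)
    exact this.trans (hfg.apply_apply_eq_zero c)))
  obtain ⟨h, hh⟩ := factor f' hf' (LinearMap.id - ψ ∘ₗ φ) (fun c => (hfg' _).1 (by
    have h1 := LinearMap.congr_fun hψ (φ c)
    have h2 := LinearMap.congr_fun hφ c
    simp only [LinearMap.comp_apply] at h1 h2
    simp [h1, h2]))
  have hid : LinearMap.id = ψ' ∘ₗ φ' + h ∘ₗ f' := by
    refine LinearMap.ext fun c => hf' ?_
    have a1 := LinearMap.congr_fun hψ' (φ' c)
    have a2 := LinearMap.congr_fun hφ' c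
    have a3 := LinearMap.congr_fun hh (f' c)
    simp only [LinearMap.comp_apply, LinearMap.sub_apply, LinearMap.id_apply] at a1 a2 a3
    simp [a1, a2, a3]
  refine auxT_retract R M K' (K × F') (LinearMap.prod φ' f') (LinearMap.coprod ψ' h) ?_
    (auxT_prod R M K F' hK)
  rw [LinearMap.coprod_comp_prod, ← hid]

open TensorProduct in
lemma aux_tmul_mk (M : Type) [AddCommGroup M] [Module R M] (I : Ideal R) :
    (∀ z : M ⊗[R] (R ⧸ I), ∃ m : M, z = m ⊗ₜ[R] (Submodule.mkQ I 1)) ∧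
    (∀ m : M, m ⊗ₜ[R] (Submodule.mkQ I 1) = 0 ↔ m ∈ I • (⊤ : Submodule R M)) := by
  have hz : ∀ m : M, TensorProduct.tensorQuotEquivQuotSMul M I (m ⊗ₜ[R] (Submodule.mkQ I 1)) =
      Submodule.Quotient.mk m := fun m => by
    have := TensorProduct.tensorQuotEquivQuotSMul_tmul_mk (I := I) m 1
    rw [one_smul] at this
    exact this
  constructor
  · intro z
    obtain ⟨m, hm⟩ := Submodule.Quotient.mk_surjective _ (TensorProduct.tensorQuotEquivQuotSMul M I z)
    refine ⟨m, (TensorProduct.tensorQuotEquivQuotSMul M I).injective ?_⟩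
    rw [hz, hm]
  · intro m
    rw [← (TensorProduct.tensorQuotEquivQuotSMul M I).map_eq_zero_iff, hz,
      Submodule.Quotient.mk_eq_zero]

open TensorProduct IsLocalRing in
lemma aux_tensor_zero [IsLocalRing R] (M N : Type) [AddCommGroup M] [Module R M]
    [AddCommGroup N] [Module R N] [Module.Finite R M] [Module.Finite R N]
    (hM : Nontrivial M) (h : Subsingleton (M ⊗[R] N)) : Subsingleton N := by
  by_contra hN
  have hk : ¬ Subsingleton (ResidueField R ⊗[R] M) := by
    rw [IsLocalRing.subsingleton_tensorProduct]
    exact not_subsingleton_iff_nontrivial.2 hM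
  have hk' : ¬ Subsingleton (ResidueField R ⊗[R] N) := by
    rwa [IsLocalRing.subsingleton_tensorProduct]
  rw [not_subsingleton_iff_nontrivial] at hk hk'
  have : Nontrivial ((ResidueField R ⊗[R] M) ⊗[ResidueField R] (ResidueField R ⊗[R] N)) := by
    infer_instance
  have e := (TensorProduct.AlgebraTensorModule.distribBaseChange R (ResidueField R) M N)
  have h2 : Subsingleton (ResidueField R ⊗[R] (M ⊗[R] N)) := inferInstance
  exact (not_subsingleton_iff_nontrivial.2 this) e.symm.injective.subsingleton

open TensorProduct in
lemma aux_step [IsNoetherianRing R] [IsLocalRing R]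
    (M : ModuleCat R) [Module.Finite R M] (hM : Nontrivial M) (hrig : TorRigid R M)
    (I : Ideal R) (x : R) (hT : AuxT R M (R ⧸ I))
    (hx : ∀ m : M, x • m ∈ I • (⊤ : Submodule R M) → m ∈ I • (⊤ : Submodule R M)) :
    AuxT R M (R ⧸ (I ⊔ Ideal.span {x})) ∧ ∀ r, x * r ∈ I → r ∈ I := by
  let J : Ideal R := LinearMap.ker (Submodule.mkQ I ∘ₗ LinearMap.mulLeft R x)
  have hJ : ∀ r, r ∈ J ↔ x * r ∈ I := fun r => by
    change Submodule.mkQ I (x * r) = 0 ↔ _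
    exact Submodule.Quotient.mk_eq_zero I
  have hIJ : I ≤ J := fun r hr => (hJ r).2 (I.mul_mem_left x hr)
  let I' : Ideal R := I ⊔ Ideal.span {x}
  have hII' : I ≤ I' := le_sup_left
  have hxI' : x ∈ I' := Ideal.mem_sup_right (Ideal.mem_span_singleton_self x)
  have hI' : ∀ r ∈ I', ∃ a, r - x * a ∈ I := fun r hr => by
    obtain ⟨y, hy, z, hz, rfl⟩ := Submodule.mem_sup.1 hr
    obtain ⟨a, rfl⟩ := Ideal.mem_span_singleton'.1 hz
    exact ⟨a, by rw [mul_comm x a, add_sub_cancel_right]; exact hy⟩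
  let μ : (R ⧸ J) →ₗ[R] (R ⧸ I) :=
    Submodule.liftQ J (Submodule.mkQ I ∘ₗ LinearMap.mulLeft R x) le_rfl
  have hμ : ∀ r, μ (Submodule.mkQ J r) = Submodule.mkQ I (x * r) := fun r => rfl
  have hμi : Function.Injective μ := by
    rw [← LinearMap.ker_eq_bot]
    exact Submodule.ker_liftQ_eq_bot' _ _ rfl
  let g : (R ⧸ I) →ₗ[R] (R ⧸ I') := Submodule.factor hII'
  have hg : ∀ r, g (Submodule.mkQ I r) = Submodule.mkQ I' r := fun r => rfl
  have hgs : Function.Surjective g := Submodule.factor_surjective hII'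
  have hmk0 : ∀ (I : Ideal R) (r : R), Submodule.mkQ I r = 0 ↔ r ∈ I := fun I r =>
    Submodule.Quotient.mk_eq_zero I
  have hexg : Function.Exact μ g := by
    intro b
    obtain ⟨b, rfl⟩ := Submodule.mkQ_surjective I b
    rw [hg, hmk0]
    constructor
    · intro hb
      obtain ⟨a, ha⟩ := hI' b hb
      refine ⟨Submodule.mkQ J a, ?_⟩
      rw [hμ, eq_comm, ← sub_eq_zero, ← map_sub, hmk0]
      exact ha
    · rintro ⟨a, ha⟩
      obtain ⟨a, rfl⟩ := Submodule.mkQ_surjective J a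
      rw [hμ, eq_comm, ← sub_eq_zero, ← map_sub, hmk0] at ha
      have := I'.add_mem (hII' ha) (I'.mul_mem_right a hxI')
      simpa using this
  have hten : Function.Injective (LinearMap.lTensor M μ) := by
    rw [← LinearMap.ker_eq_bot, LinearMap.ker_eq_bot']
    intro z hz
    obtain ⟨m, rfl⟩ := (aux_tmul_mk R M J).1 z
    rw [LinearMap.lTensor_tmul, hμ, ← smul_eq_mul, map_smul, TensorProduct.tmul_smul,
      TensorProduct.smul_tmul', (aux_tmul_mk R M I).2] at hz
    rw [(aux_tmul_mk R M J).2]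
    exact Submodule.smul_mono_left hIJ (hx m hz)
  have T1 : AuxT R M (R ⧸ I') := auxT_third R M _ _ _ μ g hexg hμi hgs hten hT
  refine ⟨T1, ?_⟩
  have t1 := (aux_tor_one R M (ModuleCat.of R (R ⧸ I'))).2 T1
  have t2 := hrig (ModuleCat.of R (R ⧸ I'))
    (inferInstanceAs (Module.Finite R (R ⧸ I'))) 1 le_rfl t1
  obtain ⟨F, K, f, p, hF, hf, hfp, hp, hK⟩ := aux_tor_two_exists R M _ t2
  have T2 : AuxT R M I' := aux_syzygy_indep R M (ModuleCat.of R (R ⧸ I')) F K (ModuleCat.of R R)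
    (ModuleCat.of R I') f p I'.subtype (Submodule.mkQ I') hF
    (inferInstanceAs (Module.Projective R R)) hf hfp hp I'.injective_subtype
    (LinearMap.exact_subtype_mkQ I') (Submodule.mkQ_surjective I') hK
  have h1 : ∀ y : I', Submodule.mkQ I (y : R) ∈ LinearMap.range μ := fun y => by
    apply (hexg _).1
    rw [hg, hmk0]; exact y.2
  let q : I' →ₗ[R] (R ⧸ J) := (LinearEquiv.ofInjective μ hμi).symm.toLinearMap ∘ₗ
    LinearMap.codRestrict (LinearMap.range μ) (Submodule.mkQ I ∘ₗ I'.subtype) h1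
  have hq : ∀ y, μ (q y) = Submodule.mkQ I (y : R) := fun y => by
    have := (LinearEquiv.ofInjective μ hμi).apply_symm_apply ⟨Submodule.mkQ I (y : R), h1 y⟩
    exact congrArg Subtype.val this
  have hq0 : ∀ y, q y = 0 ↔ (y : R) ∈ I := fun y => by
    rw [← hmk0 I, ← hq, map_eq_zero_iff μ hμi]
  have T3 : AuxT R M (R ⧸ J) := by
    refine auxT_third R M I I' (R ⧸ J) (Submodule.inclusion hII') q ?_
      (Submodule.inclusion_injective hII') ?_ ?_ T2
    · intro y
      rw [hq0]
      constructor
      · intro h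
        exact ⟨⟨y, h⟩, rfl⟩
      · rintro ⟨a, rfl⟩
        exact a.2
    · intro a
      obtain ⟨a, rfl⟩ := Submodule.mkQ_surjective J a
      exact ⟨⟨x * a, I'.mul_mem_right a hxI'⟩, hμi (by rw [hq, hμ])⟩
    · have := hT I R I.subtype (Submodule.mkQ I) I.injective_subtype
        (LinearMap.exact_subtype_mkQ I) (Submodule.mkQ_surjective I)
      refine Function.Injective.of_comp (f := LinearMap.lTensor M I'.subtype) ?_
      rw [← LinearMap.coe_comp, ← LinearMap.lTensor_comp]
      exact this
  let π : (R ⧸ I) →ₗ[R] (R ⧸ J) := Submodule.factor hIJ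
  have hπ : ∀ r, π (Submodule.mkQ I r) = Submodule.mkQ J r := fun r => rfl
  let N := LinearMap.ker π
  have hN := T3 N (R ⧸ I) N.subtype π N.injective_subtype (LinearMap.exact_subtype_ker_map _)
    (Submodule.factor_surjective hIJ)
  have hzero : LinearMap.lTensor M N.subtype = 0 := by
    refine TensorProduct.ext' fun m n => ?_
    obtain ⟨n, hn⟩ := n
    obtain ⟨j, rfl⟩ := Submodule.mkQ_surjective I n
    have hj : j ∈ J := (hmk0 J j).1 hn
    rw [LinearMap.lTensor_tmul, LinearMap.zero_apply]
    change m ⊗ₜ[R] (Submodule.mkQ I j) = 0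
    have : Submodule.mkQ I j = j • Submodule.mkQ I 1 := by
      rw [← map_smul, smul_eq_mul, mul_one]
    rw [this, TensorProduct.tmul_smul, TensorProduct.smul_tmul', (aux_tmul_mk R M I).2]
    apply hx
    rw [← mul_smul]
    exact Submodule.smul_mem_smul ((hJ j).1 hj) trivial
  have hsub : Subsingleton (M ⊗[R] N) := ⟨fun a b => hN (by rw [hzero]; rfl)⟩
  have hfin : Module.Finite R N := inferInstance
  have hN0 := aux_tensor_zero R M N hM hsub
  intro r hr
  have hrN : Submodule.mkQ I r ∈ N := (hmk0 J r).2 ((hJ r).2 hr)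
  have := Subsingleton.elim (⟨_, hrN⟩ : N) 0
  exact (hmk0 I r).1 (congrArg Subtype.val this)

open IsLocalRing RingTheory.Sequence in
lemma aux_key [IsNoetherianRing R] [IsLocalRing R]
    (M : ModuleCat R) [Module.Finite R M] (hM : Nontrivial M) (hrig : TorRigid R M)
    (rs : List R) (hm : ∀ r ∈ rs, r ∈ maximalIdeal R) (hr : IsRegular M rs) : IsRegular R rs := by
  have reg : ∀ (N : Type) [AddCommGroup N] [Module R N] (I : Ideal R) (x : R),
      IsSMulRegular (N ⧸ (I • ⊤ : Submodule R N)) x ↔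
      ∀ m : N, x • m ∈ I • (⊤ : Submodule R N) → m ∈ I • (⊤ : Submodule R N) := by
    intro N _ _ I x
    rw [isSMulRegular_iff_right_eq_zero_of_smul]
    constructor
    · intro h m hm
      rw [← Submodule.Quotient.mk_eq_zero]
      apply h
      rw [← Submodule.Quotient.mk_smul, Submodule.Quotient.mk_eq_zero]
      exact hm
    · intro h m hm
      obtain ⟨m, rfl⟩ := Submodule.Quotient.mk_surjective _ m
      rw [← Submodule.Quotient.mk_smul, Submodule.Quotient.mk_eq_zero] at hm
      rw [Submodule.Quotient.mk_eq_zero]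
      exact h m hm
  have hw := hr.toIsWeaklyRegular
  have hT : ∀ i, i ≤ rs.length → AuxT R M (R ⧸ Ideal.ofList (rs.take i)) := by
    intro i
    induction i with
    | zero =>
      intro _
      have e : Ideal.ofList (rs.take 0) = ⊥ := by simp
      rw [e]
      have : Module.Projective R (R ⧸ (⊥ : Ideal R)) :=
        Module.Projective.of_equiv (Submodule.quotEquivOfEqBot (⊥ : Submodule R R) rfl).symm
      exact auxT_proj R M _
    | succ i ih =>
      intro hi
      have := (aux_step R M hM hrig _ (rs[i]'hi) (ih (by omega))
        ((reg M _ _).1 (hw.regular_mod_prev i hi))).1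
      have e : Ideal.ofList (rs.take (i+1)) =
          Ideal.ofList (rs.take i) ⊔ Ideal.span {rs[i]'hi} := by
        rw [List.take_succ_eq_append_getElem hi, Ideal.ofList_append, Ideal.ofList_singleton]
      rw [e]; exact this
  have hR : IsWeaklyRegular R rs := by
    refine ⟨fun i hi => (reg R _ _).2 ?_⟩
    have := (aux_step R M hM hrig _ (rs[i]'hi) (hT i (by omega))
        ((reg M _ _).1 (hw.regular_mod_prev i hi))).2
    simpa using this
  exact (IsLocalRing.isRegular_iff_isWeaklyRegular_of_subset_maximalIdeal hm).2 hR

/-- a local ring admitting a nonzero f.g. maximal Cohen-Macaulay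
Tor-rigid module is Cohen-Macaulay. -/
theorem stmt2 [IsNoetherianRing R] [IsLocalRing R]
    (M : ModuleCat R) [Module.Finite R M] (hM : Nontrivial M)
    (hrig : TorRigid R M)
    (hmcm : (depth R M : WithBot ℕ∞) = ringKrullDim R) :
    (depth R (ModuleCat.of R R) : WithBot ℕ∞) = ringKrullDim R := by
  exact aux_final R M hM (fun rs => aux_key R M hM hrig rs) hmcm
end
end

section
/- Let (R, m) be a commutative Noetherian local ring and M a nonzero finitely generated Tor-rigid R-module. If Ext^n_R(M,M) = 0 for some positive integer n, then the projective dimension of M is at most n-1. -/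
open CategoryTheory

noncomputable section

variable (R : Type) [CommRing R]

section Aux
open Limits

structure Res (T : ModuleCat.{0} R) where
  G : ℕ → ModuleCat.{0} R
  d : ∀ i, G (i + 1) →ₗ[R] G i
  p : G 0 →ₗ[R] T
  proj : ∀ i, Module.Projective R (G i)
  exact : ∀ i, Function.Exact (d (i + 1)) (d i)
  exact0 : Function.Exact (d 0) p
  surj : Function.Surjective p

variable {R}

def Res.cplx {T : ModuleCat.{0} R} (S : Res R T) : ChainComplex (ModuleCat.{0} R) ℕ :=
  ChainComplex.of S.G (fun i => ModuleCat.ofHom (S.d i)) (fun i => by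
    ext x
    exact (S.exact i).apply_apply_eq_zero x)

lemma Res.cplx_d {T : ModuleCat.{0} R} (S : Res R T) (i : ℕ) :
    S.cplx.d (i + 1) i = ModuleCat.ofHom (S.d i) := by
  simp [Res.cplx]

lemma Res.cplx_exactAt {T : ModuleCat.{0} R} (S : Res R T) (i : ℕ) :
    S.cplx.ExactAt (i + 1) := by
  rw [HomologicalComplex.exactAt_iff' _ (i + 1 + 1) (i + 1) i (by simp) (by simp)]
  rw [ShortComplex.ShortExact.moduleCat_exact_iff_function_exact]
  change Function.Exact (S.cplx.d (i + 1 + 1) (i + 1)) (S.cplx.d (i + 1) i)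
  rw [S.cplx_d, S.cplx_d]
  exact S.exact i

def Res.aug {T : ModuleCat.{0} R} (S : Res R T) : S.cplx.X 0 ⟶ T := ModuleCat.ofHom S.p

lemma Res.d_aug {T : ModuleCat.{0} R} (S : Res R T) : S.cplx.d 1 0 ≫ S.aug = 0 := by
  rw [S.cplx_d]
  ext x
  exact S.exact0.apply_apply_eq_zero x

lemma Res.aug_exact {T : ModuleCat.{0} R} (S : Res R T) :
    (ShortComplex.mk _ _ S.d_aug).Exact := by
  rw [ShortComplex.ShortExact.moduleCat_exact_iff_function_exact]
  change Function.Exact (S.cplx.d 1 0) S.aug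
  rw [S.cplx_d]
  exact S.exact0

lemma Res.aug_epi {T : ModuleCat.{0} R} (S : Res R T) : Epi S.aug :=
  (ModuleCat.epi_iff_surjective _).2 S.surj

def Res.toPR {T : ModuleCat.{0} R} (S : Res R T) : ProjectiveResolution T where
  complex := S.cplx
  projective n := (IsProjective.iff_projective (R := R) (S.G n)).1 (S.proj n)
  π := (ChainComplex.toSingle₀Equiv _ _).symm ⟨S.aug, S.d_aug⟩
  quasiIso := ⟨fun n => by
    cases n
    · rw [ChainComplex.quasiIsoAt₀_iff, ShortComplex.quasiIso_iff_of_zeros']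
      · refine (ShortComplex.exact_and_epi_g_iff_of_iso ?_).2
          ⟨S.aug_exact, S.aug_epi⟩
        exact ShortComplex.isoMk (Iso.refl _) (Iso.refl _) (Iso.refl _)
          (by simp; exact (Category.id_comp _).trans (Category.comp_id _).symm)
          (by simp; exact (Category.id_comp _).trans (Category.comp_id _).symm)
      all_goals rfl
    · rw [quasiIsoAt_iff_exactAt']
      · apply S.cplx_exactAt
      · apply ChainComplex.exactAt_succ_single_obj⟩

lemma Res.tor_iff {T : ModuleCat.{0} R} (S : Res R T) (N : ModuleCat.{0} R) (i : ℕ) :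
    Subsingleton (tor R (i + 1) N T) ↔
    Function.Exact ((S.d (i + 1)).lTensor N) ((S.d i).lTensor N) := by
  rw [← ModuleCat.isZero_iff_subsingleton]
  refine (S.toPR.isoLeftDerivedObj ((MonoidalCategory.tensoringLeft (ModuleCat R)).obj N)
    (i + 1)).isZero_iff.trans ?_
  refine (HomologicalComplex.exactAt_iff_isZero_homology _ _).symm.trans ?_
  rw [HomologicalComplex.exactAt_iff' _ (i + 1 + 1) (i + 1) i (by simp) (by simp)]
  rw [ShortComplex.ShortExact.moduleCat_exact_iff_function_exact]
  change Function.Exact (((MonoidalCategory.tensoringLeft (ModuleCat R)).obj N).map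
    (S.cplx.d (i + 1 + 1) (i + 1))) (((MonoidalCategory.tensoringLeft (ModuleCat R)).obj N).map
    (S.cplx.d (i + 1) i)) ↔ _
  rw [S.cplx_d, S.cplx_d]
  rfl

lemma Res.ext_iff {T : ModuleCat.{0} R} (S : Res R T) (N : ModuleCat.{0} R) (i : ℕ) :
    Subsingleton (ext R (i + 1) T N) ↔
    ∀ f : S.G (i + 1) →ₗ[R] N, f ∘ₗ S.d (i + 1) = 0 → ∃ g : S.G i →ₗ[R] N, g ∘ₗ S.d i = f := by
  rw [← ModuleCat.isZero_iff_subsingleton]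
  rw [(S.toPR.isoExt (R := R) (i + 1) N).isZero_iff]
  refine (HomologicalComplex.exactAt_iff_isZero_homology _ _).symm.trans ?_
  rw [HomologicalComplex.exactAt_iff' _ i (i + 1) (i + 1 + 1) (by simp) (by simp)]
  rw [ShortComplex.moduleCat_exact_iff]
  change (∀ f : S.cplx.X (i + 1) ⟶ N, S.cplx.d (i + 1 + 1) (i + 1) ≫ f = 0 →
    ∃ g : S.cplx.X i ⟶ N, S.cplx.d (i + 1) i ≫ g = f) ↔ _
  rw [S.cplx_d, S.cplx_d]
  constructor
  · intro h f hf
    obtain ⟨g, hg⟩ := h (ModuleCat.ofHom f) (by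
      ext x
      exact LinearMap.congr_fun hf x)
    exact ⟨g.hom, by rw [← ModuleCat.hom_ofHom f, ← hg]; rfl⟩
  · intro h f hf
    obtain ⟨g, hg⟩ := h f.hom (by
      ext x
      exact ConcreteCategory.congr_hom hf x)
    exact ⟨ModuleCat.ofHom g, by
      ext x
      exact LinearMap.congr_fun hg x⟩

open TensorProduct

lemma swap {A B C D : Type} [AddCommGroup A] [Module R A] [AddCommGroup B] [Module R B]
    [AddCommGroup C] [Module R C] [AddCommGroup D] [Module R D] (f : A →ₗ[R] B)
    (g : C →ₗ[R] D) (x : A ⊗[R] C) :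
    g.lTensor B (f.rTensor C x) = f.rTensor D (g.lTensor A x) := by
  induction x with
  | zero => simp
  | tmul a c => simp
  | add x y hx hy => simp only [map_add, hx, hy]

lemma shift_exact {K F N G3 G2 G1 G0 : Type} [AddCommGroup K] [Module R K] [AddCommGroup F]
    [Module R F] [AddCommGroup N] [Module R N] [AddCommGroup G3] [Module R G3]
    [AddCommGroup G2] [Module R G2] [AddCommGroup G1] [Module R G1] [AddCommGroup G0] [Module R G0]
    [Module.Flat R F] [Module.Flat R G1]
    (k : K →ₗ[R] F) (q : F →ₗ[R] N) (hk : Function.Injective k) (hkq : Function.Exact k q)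
    (hq : Function.Surjective q)
    (a : G3 →ₗ[R] G2) (b : G2 →ₗ[R] G1) (c : G1 →ₗ[R] G0) (hab : Function.Exact a b)
    (hbc : Function.Exact b c)
    (h : Function.Exact (a.lTensor N) (b.lTensor N)) :
    Function.Exact (b.lTensor K) (c.lTensor K) := by
  intro x
  constructor
  · intro hx
    have h1 : c.lTensor F (k.rTensor G1 x) = 0 := by rw [swap, hx, map_zero]
    obtain ⟨y, hy⟩ := (Module.Flat.lTensor_exact F hbc _).1 h1
    have h2 : b.lTensor N (q.rTensor G2 y) = 0 := by
      rw [swap, hy]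
      exact (rTensor_exact G1 hkq hq).apply_apply_eq_zero x
    obtain ⟨z, hz⟩ := (h _).1 h2
    obtain ⟨w, rfl⟩ := LinearMap.rTensor_surjective G3 hq z
    have h3 : q.rTensor G2 (y - a.lTensor F w) = 0 := by
      rw [map_sub, ← hz, swap, sub_self]
    obtain ⟨v, hv⟩ := (rTensor_exact G2 hkq hq _).1 h3
    refine ⟨v, Module.Flat.rTensor_preserves_injective_linearMap (M := G1) k hk ?_⟩
    rw [← swap, hv, map_sub, hy, (Module.Flat.lTensor_exact F hab).apply_apply_eq_zero, sub_zero]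
  · rintro ⟨v, rfl⟩
    rw [← LinearMap.comp_apply, ← LinearMap.lTensor_comp, hbc.linearMap_comp_eq_zero]
    simp

def Res.ofMap {A B : ModuleCat.{0} R} (a : A →ₗ[R] B) (hA : Module.Projective R A)
    (hB : Module.Projective R B) (S : Res R (ModuleCat.of R (LinearMap.ker a))) :
    Res R (ModuleCat.of R (B ⧸ LinearMap.range a)) where
  G
    | 0 => B
    | 1 => A
    | i + 2 => S.G i
  d
    | 0 => a
    | 1 => (LinearMap.ker a).subtype ∘ₗ S.p
    | i + 2 => S.d i
  p := (LinearMap.range a).mkQ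
  proj
    | 0 => hB
    | 1 => hA
    | i + 2 => S.proj i
  exact
    | 0 => by
      intro x
      constructor
      · intro hx
        obtain ⟨y, hy⟩ := S.surj ⟨x, hx⟩
        exact ⟨y, congrArg Subtype.val hy⟩
      · rintro ⟨y, rfl⟩
        exact (S.p y).2
    | 1 => by
      intro x
      refine Iff.trans ?_ (S.exact0 x)
      exact (Submodule.coe_eq_zero (x := S.p x))
    | i + 2 => S.exact i
  exact0 := LinearMap.exact_map_mkQ_range a
  surj := Submodule.mkQ_surjective _

lemma exists_finFree_exact [IsNoetherianRing R] {k : ℕ} (T : Type) [AddCommGroup T] [Module R T]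
    (f : (Fin k → R) →ₗ[R] T) :
    ∃ (m : ℕ) (g : (Fin m → R) →ₗ[R] (Fin k → R)), Function.Exact g f := by
  obtain ⟨m, g, hg⟩ := Module.Finite.exists_fin' R (LinearMap.ker f)
  refine ⟨m, (LinearMap.ker f).subtype ∘ₗ g, ?_⟩
  rw [LinearMap.exact_iff, LinearMap.range_comp, LinearMap.range_eq_top.2 hg]
  simp

def resState [IsNoetherianRing R] (s0 : Σ' (k l : ℕ), (Fin k → R) →ₗ[R] (Fin l → R)) :
    ℕ → Σ' (k l : ℕ), (Fin k → R) →ₗ[R] (Fin l → R)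
  | 0 => s0
  | i + 1 => ⟨(exists_finFree_exact _ (resState s0 i).2.2).choose, (resState s0 i).1,
      (exists_finFree_exact _ (resState s0 i).2.2).choose_spec.choose⟩

lemma exists_res_s6 [IsNoetherianRing R] (T : ModuleCat.{0} R) [Module.Finite R T] :
    ∃ S : Res R T, ∀ i, Module.Finite R (S.G i) ∧ Module.Free R (S.G i) := by
  obtain ⟨l, p, hp⟩ := Module.Finite.exists_fin' R T
  obtain ⟨k, g, hg⟩ := exists_finFree_exact T p
  let s := resState (R := R) ⟨k, l, g⟩
  refine ⟨{
    G := fun i => ModuleCat.of R (Fin (s i).2.1 → R)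
    d := fun i => (s i).2.2
    p := p
    proj := fun i => inferInstanceAs (Module.Projective R (Fin (s i).2.1 → R))
    exact := fun i => (exists_finFree_exact _ (s i).2.2).choose_spec.choose_spec
    exact0 := hg
    surj := hp }, fun i => ⟨inferInstanceAs (Module.Finite R (Fin (s i).2.1 → R)),
      inferInstanceAs (Module.Free R (Fin (s i).2.1 → R))⟩⟩

lemma Res.shift {M : ModuleCat.{0} R} (F : Res R M) {T : ModuleCat.{0} R} (S : Res R T) (m : ℕ) :
    ∀ i, Function.Exact ((S.d (i + m + 2)).lTensor M) ((S.d (i + m + 1)).lTensor M) →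
    Function.Exact ((S.d (i + 1)).lTensor (LinearMap.range (F.d m)))
      ((S.d i).lTensor (LinearMap.range (F.d m))) := by
  have hF := F.proj
  have hS := S.proj
  induction m with
  | zero =>
    intro i h
    refine shift_exact (LinearMap.range (F.d 0)).subtype F.p (Submodule.subtype_injective _)
      ?_ F.surj _ _ _ (S.exact _) (S.exact _) h
    rw [LinearMap.exact_iff, Submodule.range_subtype]
    exact F.exact0.linearMap_ker_eq
  | succ m ih =>
    intro i h
    have h' := ih (i + 1) (by
      rw [show i + 1 + m = i + (m + 1) by omega]
      exact h)
    refine shift_exact (LinearMap.range (F.d (m + 1))).subtype (F.d m).rangeRestrict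
      (Submodule.subtype_injective _)
      ?_ (LinearMap.surjective_rangeRestrict _) _ _ _ (S.exact _) (S.exact _) h'
    rw [LinearMap.exact_iff, Submodule.range_subtype, LinearMap.ker_rangeRestrict]
    exact (F.exact m).linearMap_ker_eq

/-- The canonical map `N ⊗ P* → Hom(P, N)`. -/
def theta (N P : Type) [AddCommGroup N] [Module R N] [AddCommGroup P] [Module R P] :
    N ⊗[R] Module.Dual R P →ₗ[R] (P →ₗ[R] N) :=
  dualTensorHom R P N ∘ₗ (TensorProduct.comm R N (Module.Dual R P)).toLinearMap

section theta
variable {N N' P P' : Type} [AddCommGroup N] [Module R N] [AddCommGroup P] [Module R P]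
  [AddCommGroup N'] [Module R N'] [AddCommGroup P'] [Module R P']

lemma theta_tmul (x : N) (f : Module.Dual R P) (y : P) :
    theta N P (x ⊗ₜ[R] f) y = f y • x := rfl

lemma theta_dualMap (f : P' →ₗ[R] P) (u : N ⊗[R] Module.Dual R P) :
    theta N P' (f.dualMap.lTensor N u) = theta N P u ∘ₗ f := by
  induction u with
  | zero => simp
  | tmul a c =>
    ext y
    simp [theta_tmul]
  | add x y hx hy => simp only [map_add, hx, hy, LinearMap.add_comp]

lemma theta_rTensor (g : N →ₗ[R] N') (u : N ⊗[R] Module.Dual R P) :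
    theta N' P (g.rTensor _ u) = g ∘ₗ theta N P u := by
  induction u with
  | zero => simp
  | tmul a c =>
    ext y
    simp [theta_tmul]
  | add x y hx hy => simp only [map_add, hx, hy, LinearMap.comp_add]

lemma theta_bijective [Module.Finite R P] [Module.Free R P] :
    Function.Bijective (theta (R := R) N P) :=
  (dualTensorHomEquivOfBasis (N := N) (Module.Free.chooseBasis R P)).bijective.comp
    (TensorProduct.comm R N (Module.Dual R P)).bijective

end theta

section steps
variable {C A B : Type} [AddCommGroup C] [Module R C] [AddCommGroup A] [Module R A]
  [AddCommGroup B] [Module R B] [Module.Finite R A] [Module.Free R A]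
  [Module.Finite R B] [Module.Free R B] [Module.Finite R C] [Module.Free R C]
  {G : Type} [AddCommGroup G] [Module R G]

lemma stepA {M : Type} [AddCommGroup M] [Module R M]
    (a : C →ₗ[R] A) (b : A →ₗ[R] B) (hab : Function.Exact a b)
    (d : G →ₗ[R] Module.Dual R A) (hd : Function.Exact d a.dualMap)
    (h : ∀ f : A →ₗ[R] M, f ∘ₗ a = 0 → ∃ g : B →ₗ[R] M, g ∘ₗ b = f) :
    Function.Exact (d.lTensor M) (a.dualMap.lTensor M) := by
  intro u
  constructor
  · intro hu
    have h1 : theta M A u ∘ₗ a = 0 := by rw [← theta_dualMap, hu, map_zero]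
    obtain ⟨g, hg⟩ := h _ h1
    obtain ⟨v, rfl⟩ := theta_bijective.2 g
    rw [← theta_dualMap] at hg
    have hv := theta_bijective.1 hg
    have hba : ∀ φ : Module.Dual R B, ∃ t, d t = b.dualMap φ := fun φ => by
      refine (hd _).1 ?_
      ext x
      simp [hab.apply_apply_eq_zero x]
    rw [← hv]
    clear hv hg h1 hu
    induction v with
    | zero => exact ⟨0, by simp⟩
    | tmul x φ =>
      obtain ⟨t, ht⟩ := hba φ
      exact ⟨x ⊗ₜ t, by simp [ht]⟩
    | add x y hx hy =>
      obtain ⟨s, hs⟩ := hx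
      obtain ⟨t, ht⟩ := hy
      exact ⟨s + t, by simp [hs, ht]⟩
  · rintro ⟨v, rfl⟩
    rw [← LinearMap.comp_apply, ← LinearMap.lTensor_comp, hd.linearMap_comp_eq_zero]
    simp

lemma stepB
    (a : C →ₗ[R] A) (b : A →ₗ[R] B) (hab : Function.Exact a b)
    (d : G →ₗ[R] Module.Dual R A) (hd : Function.Exact d a.dualMap)
    (h : Function.Exact (d.lTensor (LinearMap.range b)) (a.dualMap.lTensor (LinearMap.range b))) :
    ∃ e : A →ₗ[R] A, b ∘ₗ e = b ∧ e ∘ₗ a = 0 := by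
  obtain ⟨u, hu⟩ := (theta_bijective (R := R) (N := LinearMap.range b) (P := A)).2 b.rangeRestrict
  have h1 : a.dualMap.lTensor (LinearMap.range b) u = 0 := by
    apply (theta_bijective (R := R) (N := LinearMap.range b) (P := C)).1
    rw [theta_dualMap, hu, map_zero]
    ext x
    simp [hab.apply_apply_eq_zero x]
  obtain ⟨v, rfl⟩ := (h u).1 h1
  obtain ⟨w, rfl⟩ := LinearMap.rTensor_surjective G (LinearMap.surjective_rangeRestrict b) v
  refine ⟨theta A A (d.lTensor A w), ?_, ?_⟩
  · rw [swap, theta_rTensor] at hu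
    ext x
    exact congrArg Subtype.val (LinearMap.congr_fun hu x)
  · rw [← theta_dualMap, ← LinearMap.comp_apply (LinearMap.lTensor A _), ← LinearMap.lTensor_comp,
      hd.linearMap_comp_eq_zero]
    simp

end steps

lemma exists_surj_residue [IsLocalRing R] (M : Type) [AddCommGroup M] [Module R M]
    [Module.Finite R M] [Nontrivial M] :
    ∃ f : M →ₗ[R] IsLocalRing.ResidueField R, Function.Surjective f := by
  have hnt : Nontrivial (IsLocalRing.ResidueField R ⊗[R] M) := by
    rw [← not_subsingleton_iff_nontrivial, IsLocalRing.subsingleton_tensorProduct,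
      not_subsingleton_iff_nontrivial]
    infer_instance
  obtain ⟨t, ht⟩ := exists_ne (0 : IsLocalRing.ResidueField R ⊗[R] M)
  obtain ⟨φ, hφ⟩ := not_forall.1
    (mt (Module.forall_dual_apply_eq_zero_iff (IsLocalRing.ResidueField R) t).1 ht)
  let f : M →ₗ[R] IsLocalRing.ResidueField R :=
    φ.restrictScalars R ∘ₗ TensorProduct.mk R (IsLocalRing.ResidueField R) M 1
  have hf : ∃ m, f m ≠ 0 := by
    by_contra! hcon
    apply hφ
    clear hφ ht
    induction t with
    | zero => simp
    | tmul c x =>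
      have : c ⊗ₜ[R] x = c • ((1 : IsLocalRing.ResidueField R) ⊗ₜ[R] x) := by
        rw [TensorProduct.smul_tmul']; simp
      rw [this, map_smul]
      have := hcon x
      simp only [f, LinearMap.comp_apply, TensorProduct.mk_apply,
        LinearMap.restrictScalars_apply] at this
      rw [this, smul_zero]
    | add x y hx hy => rw [map_add, hx, hy, add_zero]
  obtain ⟨m, hm⟩ := hf
  refine ⟨f, fun y => ?_⟩
  obtain ⟨r, hr⟩ := IsLocalRing.residue_surjective (y / f m)
  refine ⟨r • m, ?_⟩
  rw [map_smul, Algebra.smul_def]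
  change IsLocalRing.residue R r * _ = _
  rw [hr, div_mul_cancel₀ _ hm]

lemma stepC [IsLocalRing R] {C A B M : Type} [AddCommGroup C] [Module R C] [AddCommGroup A]
    [Module R A] [AddCommGroup B] [Module R B] [Module.Finite R A] [Module.Free R A]
    [Module.Finite R B] [Module.Free R B]
    [AddCommGroup M] [Module R M] [Module.Finite R M] [Nontrivial M]
    (a : C →ₗ[R] A) (b : A →ₗ[R] B) (hab : Function.Exact a b)
    (h : ∀ f : A →ₗ[R] M, f ∘ₗ a = 0 → ∃ g : B →ₗ[R] M, g ∘ₗ b = f)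
    (e : A →ₗ[R] A) (he : b ∘ₗ e = b) (hea : e ∘ₗ a = 0) :
    ∃ s : B →ₗ[R] A, b ∘ₗ s ∘ₗ b = b := by
  have hker : LinearMap.ker b ≤ LinearMap.ker e := by
    intro x hx
    obtain ⟨y, rfl⟩ := (hab x).1 hx
    exact LinearMap.congr_fun hea y
  let σ : LinearMap.range b →ₗ[R] A :=
    (LinearMap.ker b).liftQ e hker ∘ₗ b.quotKerEquivRange.symm.toLinearMap
  have hσ : ∀ x, σ (b.rangeRestrict x) = e x := by
    intro x
    have : b.quotKerEquivRange.symm (b.rangeRestrict x) = (LinearMap.ker b).mkQ x := by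
      rw [LinearEquiv.symm_apply_eq]
      rfl
    simp only [σ, LinearMap.comp_apply, LinearEquiv.coe_coe, this]
    rfl
  have hσ' : b.rangeRestrict ∘ₗ σ = LinearMap.id := by
    ext ⟨_, x, rfl⟩
    have := hσ x
    change ((b.rangeRestrict (σ (b.rangeRestrict x)) : LinearMap.range b) : B) = b x
    rw [this]
    exact LinearMap.congr_fun he x
  have hproj : Module.Projective R (LinearMap.range b) :=
    Module.Projective.of_split σ b.rangeRestrict hσ'
  obtain ⟨κ, hκ⟩ := exists_surj_residue (R := R) M
  have hext : ∀ f : LinearMap.range b →ₗ[R] IsLocalRing.ResidueField R,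
      ∃ g : B →ₗ[R] IsLocalRing.ResidueField R, g ∘ₗ (LinearMap.range b).subtype = f := by
    intro f
    obtain ⟨f', hf'⟩ := Module.projective_lifting_property κ f hκ
    obtain ⟨g, hg⟩ := h (f' ∘ₗ b.rangeRestrict) (by
      ext x
      have : b.rangeRestrict (a x) = 0 := Subtype.ext (hab.apply_apply_eq_zero x)
      simp only [LinearMap.comp_apply, this, map_zero, LinearMap.zero_apply])
    refine ⟨κ ∘ₗ g, ?_⟩
    ext ⟨_, x, rfl⟩
    rw [← hf']
    exact congrArg κ (LinearMap.congr_fun hg x)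
  have hinj : Function.Injective
      ((LinearMap.range b).subtype.lTensor (IsLocalRing.ResidueField R)) := by
    rw [injective_iff_map_eq_zero]
    intro t ht
    by_contra htne
    obtain ⟨φ, hφ⟩ := not_forall.1
      (mt (Module.forall_dual_apply_eq_zero_iff (IsLocalRing.ResidueField R) t).1 htne)
    obtain ⟨g, hg⟩ := hext
      (φ.restrictScalars R ∘ₗ TensorProduct.mk R (IsLocalRing.ResidueField R) _ 1)
    have key : ∀ t : IsLocalRing.ResidueField R ⊗[R] LinearMap.range b,
        LinearMap.mul' R (IsLocalRing.ResidueField R) (g.lTensor (IsLocalRing.ResidueField R)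
          ((LinearMap.range b).subtype.lTensor (IsLocalRing.ResidueField R) t)) = φ t := by
      intro t
      induction t with
      | zero => simp
      | tmul c x =>
        have h1 : c ⊗ₜ[R] x = c • ((1 : IsLocalRing.ResidueField R) ⊗ₜ[R] x) := by
          rw [TensorProduct.smul_tmul']; simp
        have h2 : g x = φ (1 ⊗ₜ[R] x) := LinearMap.congr_fun hg x
        have h3 : φ (c ⊗ₜ[R] x) = c • g x := by rw [h1, map_smul, ← h2]
        rw [h3]
        simp
      | add x y hx hy => simp only [map_add, hx, hy]
    apply hφ
    rw [← key, ht]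
    simp
  obtain ⟨l, hl⟩ := (IsLocalRing.split_injective_iff_lTensor_residueField_injective _).2 hinj
  refine ⟨σ ∘ₗ l, ?_⟩
  ext x
  have h1 : l (b x) = b.rangeRestrict x := LinearMap.congr_fun hl (b.rangeRestrict x)
  simp only [LinearMap.comp_apply, h1, hσ]
  exact LinearMap.congr_fun he x

lemma Res.split {M : ModuleCat.{0} R} (F : Res R M) (m : ℕ)
    (h : ∃ s : F.G m →ₗ[R] F.G (m + 1), F.d m ∘ₗ s ∘ₗ F.d m = F.d m) (j : ℕ) :
    ∃ s : F.G (m + j) →ₗ[R] F.G (m + j + 1), F.d (m + j) ∘ₗ s ∘ₗ F.d (m + j) = F.d (m + j) := by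
  induction j with
  | zero => exact h
  | succ j ih =>
    obtain ⟨s, hs⟩ := ih
    have := F.proj (m + j + 1)
    have hr : ∀ x, x - s (F.d (m + j) x) ∈ LinearMap.range (F.d (m + j + 1)) := by
      intro x
      refine (F.exact (m + j) _).1 ?_
      rw [map_sub, sub_eq_zero]
      exact (LinearMap.congr_fun hs x).symm
    obtain ⟨t, ht⟩ := Module.projective_lifting_property (F.d (m + j + 1)).rangeRestrict
      (LinearMap.codRestrict (LinearMap.range (F.d (m + j + 1)))
        (LinearMap.id - s ∘ₗ F.d (m + j)) hr) (LinearMap.surjective_rangeRestrict _)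
    refine ⟨t, ?_⟩
    ext x
    have h1 := congrArg Subtype.val (LinearMap.congr_fun ht (F.d (m + j + 1) x))
    refine Eq.trans h1 ?_
    simp [(F.exact (m + j)).apply_apply_eq_zero x]
    rfl

lemma Res.ext_zero_of_split {M : ModuleCat.{0} R} (F : Res R M) (m : ℕ)
    (h : ∃ s : F.G m →ₗ[R] F.G (m + 1), F.d m ∘ₗ s ∘ₗ F.d m = F.d m) (Y : ModuleCat.{0} R) :
    Subsingleton (ext R (m + 1) M Y) := by
  rw [F.ext_iff]
  obtain ⟨s, hs⟩ := h
  intro f hf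
  refine ⟨f ∘ₗ s, ?_⟩
  ext x
  have hr : x - s (F.d m x) ∈ LinearMap.range (F.d (m + 1)) := by
    refine (F.exact m _).1 ?_
    rw [map_sub, sub_eq_zero]
    exact (LinearMap.congr_fun hs x).symm
  obtain ⟨y, hy⟩ := hr
  have h1 := LinearMap.congr_fun hf y
  simp only [LinearMap.comp_apply, hy, map_sub, LinearMap.zero_apply, sub_eq_zero] at h1
  exact h1.symm

lemma main_split [IsNoetherianRing R] [IsLocalRing R]
    (M : ModuleCat.{0} R) [Module.Finite R M] (hM : Nontrivial M)
    (hrig : TorRigid R M) (m : ℕ) (h : Subsingleton (ext R (m + 1) M M))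
    (F : Res R M) (hfin : ∀ i, Module.Finite R (F.G i)) (hfree : ∀ i, Module.Free R (F.G i)) :
    ∃ s : F.G m →ₗ[R] F.G (m + 1), F.d m ∘ₗ s ∘ₗ F.d m = F.d m := by
  rw [F.ext_iff] at h
  let A : ModuleCat.{0} R := ModuleCat.of R (Module.Dual R (F.G (m + 1)))
  let B : ModuleCat.{0} R := ModuleCat.of R (Module.Dual R (F.G (m + 1 + 1)))
  let a : A →ₗ[R] B := (F.d (m + 1)).dualMap
  have fA : Module.Finite R A := inferInstanceAs (Module.Finite R (Module.Dual R _))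
  have fB : Module.Finite R B := inferInstanceAs (Module.Finite R (Module.Dual R _))
  have pA : Module.Projective R A := inferInstanceAs (Module.Projective R (Module.Dual R _))
  have pB : Module.Projective R B := inferInstanceAs (Module.Projective R (Module.Dual R _))
  have fK : Module.Finite R (ModuleCat.of R (LinearMap.ker a)) :=
    inferInstanceAs (Module.Finite R (LinearMap.ker a))
  obtain ⟨S0, -⟩ := exists_res_s6 (ModuleCat.of R (LinearMap.ker a))
  let S := Res.ofMap a pA pB S0
  have h1 : Subsingleton (tor R 1 M (ModuleCat.of R (B ⧸ LinearMap.range a))) :=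
    (S.tor_iff M 0).2 (stepA (F.d (m + 1)) (F.d m) (F.exact m) (S.d 1) (S.exact 0) h)
  have h2 : ∀ i, Subsingleton (tor R (i + 1) M (ModuleCat.of R (B ⧸ LinearMap.range a))) := by
    intro i
    induction i with
    | zero => exact h1
    | succ i ih =>
      exact hrig _ (inferInstanceAs (Module.Finite R (B ⧸ LinearMap.range a))) _ (by omega) ih
  have h3 := F.shift S m 0 (by
    rw [Nat.zero_add]
    exact (S.tor_iff M (m + 1)).1 (h2 _))
  obtain ⟨e, he, hea⟩ := stepB (F.d (m + 1)) (F.d m) (F.exact m) (S.d 1) (S.exact 0) h3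
  exact stepC (F.d (m + 1)) (F.d m) (F.exact m) h e he hea

end Aux

/-- if `M` is Tor-rigid and `Ext^n_R(M,M) = 0` for some `n ≥ 1`,
then `pd M ≤ n - 1`. -/
theorem stmt6 [IsNoetherianRing R] [IsLocalRing R]
    (M : ModuleCat R) [Module.Finite R M] (hM : Nontrivial M)
    (hrig : TorRigid R M)
    (n : ℕ) (hn : 1 ≤ n) (h : Subsingleton (ext R n M M)) :
    projDim R M ≤ ((n - 1 : ℕ) : ℕ∞) := by
  obtain ⟨m, rfl⟩ : ∃ m, n = m + 1 := ⟨n - 1, by omega⟩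
  obtain ⟨F, hF⟩ := exists_res_s6 M
  have hs := main_split M hM hrig m h F (fun i => (hF i).1) (fun i => (hF i).2)
  refine sInf_le ?_
  intro i X hi
  have hi' : m < i := by
    simpa using hi
  obtain ⟨j, rfl⟩ : ∃ j, i = m + j + 1 := ⟨i - m - 1, by omega⟩
  exact F.ext_zero_of_split _ (F.split m hs j) X
end
end
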